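/- arXiv:2501.10152 — 18 statements merged into one kernel-verified Lean document; each statement's English description precedes it below -/
import Mathlib

section
/- Let d ≥ 2 and v ≥ 2 be integers, ε > 0, and let ψ_1, …, ψ_v be unit vectors in ℂ^d. For μ ∈ [0, d/(d−1)], define the matrices Q_x = (μ/d)·I_d + (1−μ)·|ψ_x⟩⟨ψ_x| for x ∈ [v]. Set c_{x,x'} = |⟨ψ_x, ψ_{x'}⟩|², c_* = min_{x ≠ x'} c_{x,x'}, and g_*^± = (1 ± √(1 + (1−c_*)/sinh²(ε/2)))/2. Then the following are equivalent: (i) for all x, x' ∈ [v], the matrix e^ε·Q_x − Q_{x'} is positive semidefinite; (ii) μ ∈ [d·g_*^−/(d·g_*^− − 1), d·g_*^+/(d·g_*^+ − 1)]. -/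
open ComplexOrder

section InnerProductSpace

variable {V : Type*} [NormedAddCommGroup V] [InnerProductSpace ℂ V]

/-- Cauchy-Schwarz for the components of `b` and `z` orthogonal to the unit vector `a`. -/
theorem norm_inner_le_of_orthogonal_split {a b : V} (ha : ‖a‖ = 1) (hb : ‖b‖ = 1) (z : V) :
    ‖inner ℂ b z‖ ≤ ‖inner ℂ a b‖ * ‖inner ℂ a z‖
      + √(1 - ‖inner ℂ a b‖ ^ 2) * √(‖z‖ ^ 2 - ‖inner ℂ a z‖ ^ 2) := by
  have haa : inner ℂ a a = (1 : ℂ) := by simp [inner_self_eq_norm_sq_to_K, ha]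
  have hnorm (w : V) : ‖w - inner ℂ a w • a‖ ^ 2 = ‖w‖ ^ 2 - ‖inner ℂ a w‖ ^ 2 := by
    rw [← Complex.ofReal_inj]
    have h := inner_self_eq_norm_sq_to_K (𝕜 := ℂ) (w - inner ℂ a w • a)
    simp only [Complex.coe_algebraMap] at h
    push_cast
    rw [← h]
    rw [inner_sub_left, inner_sub_right, inner_sub_right, inner_smul_left, inner_smul_left,
      inner_smul_right, inner_smul_right, haa, inner_self_eq_norm_sq_to_K,
      ← Complex.conj_mul', ← inner_conj_symm w a]
    simp only [Complex.coe_algebraMap]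
    ring
  have hinner : inner ℂ b z = inner ℂ b a * inner ℂ a z
      + inner ℂ (b - inner ℂ a b • a) (z - inner ℂ a z • a) := by
    simp only [inner_sub_left, inner_sub_right, inner_smul_left, inner_smul_right, haa,
      inner_conj_symm]
    ring
  rw [hinner]
  refine (norm_add_le _ _).trans ?_
  have hb2 : 1 - ‖inner ℂ a b‖ ^ 2 = ‖b - inner ℂ a b • a‖ ^ 2 := by rw [hnorm, hb, one_pow]
  rw [norm_mul, norm_inner_symm b a, hb2, ← hnorm,
    Real.sqrt_sq (norm_nonneg _), Real.sqrt_sq (norm_nonneg _)]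
  gcongr
  exact norm_inner_le_norm _ _

/-- The rank-one form of `b` is dominated by `A |a⟩⟨a| + ν I` when the pencil's determinant
condition holds. -/
theorem norm_inner_sq_le_of_overlap {a b : V} (ha : ‖a‖ = 1) (hb : ‖b‖ = 1) {A ν : ℝ}
    (hA : 0 < A) (hν : 0 ≤ ν)
    (hAν : 1 ≤ A + ν) (h : ν + (1 - ‖inner ℂ a b‖ ^ 2) * A ≤ ν * (A + ν)) (z : V) :
    ‖inner ℂ b z‖ ^ 2 ≤ A * ‖inner ℂ a z‖ ^ 2 + ν * ‖z‖ ^ 2 := by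
  have hs := norm_inner_le_norm (𝕜 := ℂ) a b
  have hp := norm_inner_le_norm (𝕜 := ℂ) a z
  rw [ha, one_mul] at hs hp
  rw [hb] at hs
  have key := norm_inner_le_of_orthogonal_split ha hb z
  have hT2 := Real.sq_sqrt (show 0 ≤ 1 - ‖inner ℂ a b‖ ^ 2 by nlinarith [norm_nonneg (inner ℂ a b)])
  have hZ2 := Real.sq_sqrt (show 0 ≤ ‖z‖ ^ 2 - ‖inner ℂ a z‖ ^ 2 by
    nlinarith [norm_nonneg (inner ℂ a z)])
  have key2 := pow_le_pow_left₀ (norm_nonneg _) key 2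
  refine key2.trans ?_
  have hT0 := Real.sqrt_nonneg (1 - ‖inner ℂ a b‖ ^ 2)
  generalize √(1 - ‖inner ℂ a b‖ ^ 2) = T at *
  generalize √(‖z‖ ^ 2 - ‖inner ℂ a z‖ ^ 2) = Z at *
  generalize ‖inner ℂ a b‖ = S at *
  generalize ‖inner ℂ a z‖ = P at *
  have hz : ‖z‖ ^ 2 = P ^ 2 + Z ^ 2 := by linarith
  rw [hz]
  have hS : S ^ 2 = 1 - T ^ 2 := by linarith
  rcases hν.eq_or_lt with rfl | hν
  · have hT : T = 0 := by
      have : T ^ 2 * A ≤ 0 := by rw [hT2]; linarith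
      have : T ^ 2 ≤ 0 := by nlinarith
      exact pow_eq_zero_iff two_ne_zero |>.1 (le_antisymm this (sq_nonneg T))
    subst hT
    have h1 : S ^ 2 = 1 := by linarith
    nlinarith [sq_nonneg P]
  · have hX : 0 < ν * (A + ν) := by positivity
    refine le_of_mul_le_mul_left ?_ hX
    have h0 : (ν * S ^ 2 + (A + ν) * T ^ 2) * ((A + ν) * P ^ 2 + ν * Z ^ 2)
        ≤ (ν * (A + ν)) * ((A + ν) * P ^ 2 + ν * Z ^ 2) := by
      apply mul_le_mul_of_nonneg_right _ (by positivity)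
      rw [hS]; rw [← hT2] at h; linarith
    nlinarith [sq_nonneg (ν * S * Z - (A + ν) * T * P)]

/-- An eigenvector of `A |a⟩⟨a| + B |b⟩⟨b|` in the span of `a` and `b`. -/
theorem exists_ne_zero_rank_two_form_eq {a b : V} (ha : ‖a‖ = 1) (hb : ‖b‖ = 1) {A B l : ℝ}
    (h : A * (l - B + B * ‖inner ℂ a b‖ ^ 2) = l * (l - B))
    (hne : l - B + B * ‖inner ℂ a b‖ ^ 2 ≠ 0) :
    ∃ z : V, z ≠ 0 ∧
      A * ‖inner ℂ a z‖ ^ 2 + B * ‖inner ℂ b z‖ ^ 2 = l * ‖z‖ ^ 2 := by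
  have haa : inner ℂ a a = (1 : ℂ) := by simp [inner_self_eq_norm_sq_to_K, ha]
  have hbb : inner ℂ b b = (1 : ℂ) := by simp [inner_self_eq_norm_sq_to_K, hb]
  have hc : inner ℂ b a * inner ℂ a b = (‖inner ℂ a b‖ : ℂ) ^ 2 := by
    rw [← inner_conj_symm b a, Complex.conj_mul']
  set z : V := ((l - B : ℝ) : ℂ) • a + ((B : ℂ) * inner ℂ b a) • b with hz
  have hp : inner ℂ a z = ((l - B + B * ‖inner ℂ a b‖ ^ 2 : ℝ) : ℂ) := by
    rw [hz, inner_add_right, inner_smul_right, inner_smul_right, haa, mul_assoc, hc]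
    push_cast; ring
  have hr : inner ℂ b z = (l : ℂ) * inner ℂ b a := by
    rw [hz, inner_add_right, inner_smul_right, inner_smul_right, hbb]
    push_cast; ring
  have hn : ‖z‖ ^ 2 = (l - B) * (l - B + B * ‖inner ℂ a b‖ ^ 2) + B * l * ‖inner ℂ a b‖ ^ 2 := by
    rw [← Complex.ofReal_inj]
    have h' := inner_self_eq_norm_sq_to_K (𝕜 := ℂ) z
    simp only [Complex.coe_algebraMap] at h'
    push_cast
    rw [← h']
    nth_rw 1 [hz]
    rw [inner_add_left, inner_smul_left, inner_smul_left, hp, hr, map_mul, inner_conj_symm,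
      Complex.conj_ofReal, Complex.conj_ofReal, ← hc]
    push_cast
    rw [← hc]
    ring
  refine ⟨z, fun h0 => hne ?_, ?_⟩
  · rw [h0, inner_zero_right] at hp
    exact_mod_cast hp.symm
  · rw [hp, hr, hn, norm_mul, norm_inner_symm b a, Complex.norm_real, Complex.norm_real,
      mul_pow, Real.norm_eq_abs, Real.norm_eq_abs, sq_abs, sq_abs]
    linear_combination (l - B + B * ‖inner ℂ a b‖ ^ 2) * h
end InnerProductSpace

theorem star_dotProduct_depolarized_sub_mulVec {ι : Type*} [Fintype ι] [DecidableEq ι]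
    (E m t : ℝ) (a b z : ι → ℂ) :
    star z ⬝ᵥ (((E : ℂ) • ((m : ℂ) • (1 : Matrix ι ι ℂ)
          + (t : ℂ) • Matrix.of (fun i j => a i * star (a j)))
        - ((m : ℂ) • (1 : Matrix ι ι ℂ)
          + (t : ℂ) • Matrix.of (fun i j => b i * star (b j)))).mulVec z)
      = (((E - 1) * m * ‖WithLp.toLp 2 z‖ ^ 2
        + t * (E * ‖inner ℂ (WithLp.toLp 2 a) (WithLp.toLp 2 z)‖ ^ 2
          - ‖inner ℂ (WithLp.toLp 2 b) (WithLp.toLp 2 z)‖ ^ 2) : ℝ) : ℂ) := by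
  have hof (w : ι → ℂ) : Matrix.of (fun i j => w i * star (w j)) =
      Matrix.vecMulVec w (star w) := rfl
  have hz : (‖WithLp.toLp 2 z‖ : ℂ) ^ 2 = star z ⬝ᵥ z := by
    have := inner_self_eq_norm_sq_to_K (𝕜 := ℂ) (WithLp.toLp 2 z)
    simp only [Complex.coe_algebraMap] at this
    rw [← this, EuclideanSpace.inner_toLp_toLp, dotProduct_comm]
  have hi (w : ι → ℂ) : (‖inner ℂ (WithLp.toLp 2 w) (WithLp.toLp 2 z)‖ : ℂ) ^ 2
      = (star z ⬝ᵥ w) * (star w ⬝ᵥ z) := by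
    rw [← Complex.conj_mul', inner_conj_symm, EuclideanSpace.inner_toLp_toLp,
      EuclideanSpace.inner_toLp_toLp, dotProduct_comm w, dotProduct_comm z]
  push_cast
  rw [hz, hi, hi, hof, hof]
  simp only [Matrix.sub_mulVec, Matrix.add_mulVec, Matrix.smul_mulVec, Matrix.one_mulVec,
    Matrix.vecMulVec_mulVec, dotProduct_sub, dotProduct_add, dotProduct_smul, smul_eq_mul,
    op_smul_eq_smul]
  ring
theorem isHermitian_depolarized {ι : Type*} [DecidableEq ι] (m t : ℝ) (a : ι → ℂ) :
    ((m : ℂ) • (1 : Matrix ι ι ℂ)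
      + (t : ℂ) • Matrix.of (fun i j => a i * star (a j))).IsHermitian := by
  ext i j
  by_cases hij : i = j
  · subst hij; simp [mul_comm]
  · simp [hij, Ne.symm hij, mul_comm]

theorem exp_sub_one_sq (ε : ℝ) :
    (Real.exp ε - 1) ^ 2 = 4 * Real.exp ε * Real.sinh (ε / 2) ^ 2 := by
  have h1 : Real.exp ε = Real.exp (ε / 2) ^ 2 := by rw [← Real.exp_nat_mul]; congr 1; ring
  have h2 : Real.exp (ε / 2) * Real.exp (-(ε / 2)) = 1 := by rw [← Real.exp_add]; simp
  rw [Real.sinh_eq, h1]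
  generalize Real.exp (ε / 2) = u at *
  generalize Real.exp (-(ε / 2)) = w at *
  linear_combination (2 * u ^ 2 - u * w - 1) * h2

/-- A privacy mechanism of the form `Q_x = (μ/d) I + (1-μ)|ψ_x⟩⟨ψ_x|`
is an ε-QLDP mechanism (i.e. `e^ε Q_x - Q_{x'}` is PSD for all `x, x'`) if and only if
`μ ∈ [d g₋/(d g₋ - 1), d g₊/(d g₊ - 1)]`. -/
theorem stmt_0 (d v : ℕ) (hd : 2 ≤ d) (hv : 2 ≤ v) (ε : ℝ) (hε : 0 < ε)
    (ψ : Fin v → Fin d → ℂ)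
    (hψ : ∀ x, ∑ i, Complex.normSq (ψ x i) = 1)
    (μ : ℝ) (hμ : μ ∈ Set.Icc (0 : ℝ) ((d : ℝ) / ((d : ℝ) - 1)))
    (Q : Fin v → Matrix (Fin d) (Fin d) ℂ)
    (hQ : ∀ x, Q x = ((μ / d : ℝ) : ℂ) • (1 : Matrix (Fin d) (Fin d) ℂ)
      + (((1 - μ : ℝ)) : ℂ) • Matrix.of (fun i j => ψ x i * star (ψ x j)))
    (cstar : ℝ)
    (hcstar : cstar = sInf {r : ℝ | ∃ x x' : Fin v, x ≠ x' ∧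
      r = Complex.normSq (∑ i, star (ψ x i) * ψ x' i)})
    (gm gp : ℝ)
    (hgm : gm = (1 - Real.sqrt (1 + (1 - cstar) / Real.sinh (ε / 2) ^ 2)) / 2)
    (hgp : gp = (1 + Real.sqrt (1 + (1 - cstar) / Real.sinh (ε / 2) ^ 2)) / 2) :
    (∀ x x' : Fin v, ((Real.exp ε : ℂ) • Q x - Q x').PosSemidef) ↔
      μ ∈ Set.Icc ((d : ℝ) * gm / ((d : ℝ) * gm - 1)) ((d : ℝ) * gp / ((d : ℝ) * gp - 1)) := by
  obtain ⟨hμ0, hμ1⟩ := hμ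
  have hd' : (2 : ℝ) ≤ d := by exact_mod_cast hd
  have hE : 1 < Real.exp ε := Real.one_lt_exp_iff.2 hε
  have hsinh : 0 < Real.sinh (ε / 2) := Real.sinh_pos_iff.2 (by positivity)
  set Ψ : Fin v → EuclideanSpace ℂ (Fin d) := fun x => WithLp.toLp 2 (ψ x) with hΨ
  have hΨ1 (x) : ‖Ψ x‖ = 1 := by
    have h : ‖Ψ x‖ ^ 2 = 1 := by
      rw [EuclideanSpace.norm_sq_eq, ← hψ x]
      simp [hΨ, Complex.normSq_eq_norm_sq]
    exact (pow_eq_one_iff_of_nonneg (norm_nonneg _) two_ne_zero).1 h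
  have hoverlap (x x') : Complex.normSq (∑ i, star (ψ x i) * ψ x' i)
      = ‖inner ℂ (Ψ x) (Ψ x')‖ ^ 2 := by
    rw [Complex.normSq_eq_norm_sq, EuclideanSpace.inner_toLp_toLp, dotProduct_comm]
    rfl
  simp only [hoverlap] at hcstar
  have hfin : {r : ℝ | ∃ x x' : Fin v, x ≠ x' ∧ r = ‖inner ℂ (Ψ x) (Ψ x')‖ ^ 2}.Finite := by
    refine (Set.finite_range
      fun p : Fin v × Fin v => ‖inner ℂ (Ψ p.1) (Ψ p.2)‖ ^ 2).subset ?_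
    rintro r ⟨x, x', -, rfl⟩
    exact ⟨(x, x'), rfl⟩
  obtain ⟨y, y', -, hyc⟩ : ∃ x x' : Fin v, x ≠ x' ∧ cstar = ‖inner ℂ (Ψ x) (Ψ x')‖ ^ 2 := by
    have hne : {r : ℝ | ∃ x x' : Fin v, x ≠ x' ∧
        r = ‖inner ℂ (Ψ x) (Ψ x')‖ ^ 2}.Nonempty :=
      ⟨_, ⟨0, by omega⟩, ⟨1, by omega⟩, by simp, rfl⟩
    exact hcstar ▸ hne.csInf_mem hfin
  have hc1 : cstar ≤ 1 := by
    have h := norm_inner_le_norm (𝕜 := ℂ) (Ψ y) (Ψ y')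
    rw [hΨ1, hΨ1, one_mul] at h
    rw [hyc]
    exact pow_le_one₀ (norm_nonneg _) h
  have hcle (x x') : cstar ≤ ‖inner ℂ (Ψ x) (Ψ x')‖ ^ 2 := by
    by_cases hxx : x = x'
    · subst hxx
      simpa [inner_self_eq_norm_sq_to_K, hΨ1] using hc1
    · rw [hcstar]
      exact csInf_le hfin.bddBelow ⟨x, x', hxx, rfl⟩
  have hquot : 0 ≤ (1 - cstar) / Real.sinh (ε / 2) ^ 2 :=
    div_nonneg (by linarith) (by positivity)
  have hK2 := Real.sq_sqrt (show 0 ≤ 1 + (1 - cstar) / Real.sinh (ε / 2) ^ 2 by linarith)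
  have hK1 : 1 ≤ √(1 + (1 - cstar) / Real.sinh (ε / 2) ^ 2) :=
    Real.one_le_sqrt.2 (by linarith)
  set K := √(1 + (1 - cstar) / Real.sinh (ε / 2) ^ 2)
  have hEK : (Real.exp ε - 1) ^ 2 * (K ^ 2 - 1) = 4 * Real.exp ε * (1 - cstar) := by
    rw [exp_sub_one_sq, hK2]
    field_simp
    ring
  have hgm0 : gm ≤ 0 := by linarith
  have hgp1 : 1 ≤ gp := by linarith
  have hqm : ((Real.exp ε - 1) * gm) ^ 2
      = (Real.exp ε - 1) * ((Real.exp ε - 1) * gm) + Real.exp ε * (1 - cstar) := by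
    rw [hgm]; linear_combination hEK / 4
  have hqp : ((Real.exp ε - 1) * gp) ^ 2
      = (Real.exp ε - 1) * ((Real.exp ε - 1) * gp) + Real.exp ε * (1 - cstar) := by
    rw [hgp]; linear_combination hEK / 4
  clear_value K
  have hm0 : 0 ≤ μ / d := by positivity
  have hIcc : μ ∈ Set.Icc ((d : ℝ) * gm / ((d : ℝ) * gm - 1)) ((d : ℝ) * gp / ((d : ℝ) * gp - 1))
      ↔ 0 ≤ μ / d + (1 - μ) * gm ∧ 0 ≤ μ / d + (1 - μ) * gp := by
    have hmul (g : ℝ) : 0 ≤ μ / d + (1 - μ) * g ↔ μ * (d * g - 1) ≤ d * g := by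
      rw [← mul_nonneg_iff_of_pos_left (show (0 : ℝ) < d by linarith),
        show (d : ℝ) * (μ / d + (1 - μ) * g) = d * g - μ * (d * g - 1) by field_simp; ring,
        sub_nonneg]
    rw [Set.mem_Icc, div_le_iff_of_neg (by nlinarith), le_div_iff₀ (by nlinarith), hmul, hmul]
  have hpsd (x x') : ((Real.exp ε : ℂ) • Q x - Q x').PosSemidef ↔
      ∀ z : EuclideanSpace ℂ (Fin d), 0 ≤ (Real.exp ε - 1) * (μ / d) * ‖z‖ ^ 2
        + (1 - μ) * (Real.exp ε * ‖inner ℂ (Ψ x) z‖ ^ 2 - ‖inner ℂ (Ψ x') z‖ ^ 2) := by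
    have hherm : ((Real.exp ε : ℂ) • Q x - Q x').IsHermitian := by
      rw [hQ, hQ]
      refine .sub ?_ (isHermitian_depolarized _ _ _)
      rw [Matrix.IsHermitian, Matrix.conjTranspose_smul, (isHermitian_depolarized _ _ _).eq,
        Complex.star_def, Complex.conj_ofReal]
    rw [Matrix.posSemidef_iff_dotProduct_mulVec, and_iff_right hherm,
      (WithLp.equiv 2 (Fin d → ℂ)).forall_congr_left]
    refine forall_congr' fun z => ?_
    rw [hQ, hQ, star_dotProduct_depolarized_sub_mulVec, Complex.zero_le_real]
    rfl
  rw [hIcc]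
  simp only [hpsd]
  clear hpsd hIcc hQ hψ hoverlap hfin hcstar
  clear_value Ψ
  set E := Real.exp ε
  constructor
  · intro h
    have hcond {g : ℝ} (hg : ∃ z : EuclideanSpace ℂ (Fin d), z ≠ 0 ∧
        ∃ x x', E * ‖inner ℂ (Ψ x) z‖ ^ 2 - ‖inner ℂ (Ψ x') z‖ ^ 2 = (E - 1) * g * ‖z‖ ^ 2) :
        0 ≤ μ / d + (1 - μ) * g := by
      obtain ⟨z, hz, x, x', hzq⟩ := hg
      have h1 := h x x' z
      rw [hzq] at h1
      have h2 : 0 < (E - 1) * ‖z‖ ^ 2 :=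
        mul_pos (by linarith) (pow_pos (norm_pos_iff.2 hz) 2)
      exact nonneg_of_mul_nonneg_right (by linarith) h2
    constructor
    · rcases hc1.eq_or_lt with hc | hc
      · have hg0 : gm = 0 := by
          have : 0 < E - 1 := by linarith
          nlinarith [mul_pos this this, hqm]
        simpa [hg0] using hm0
      · apply hcond
        rw [← norm_inner_symm] at hyc
        obtain ⟨z, hz, hzq⟩ := exists_ne_zero_rank_two_form_eq (hΨ1 y') (hΨ1 y)
          (A := -1) (B := E) (l := (E - 1) * gm)
          (by rw [← hyc]; linear_combination -hqm) (by rw [← hyc]; nlinarith)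
        exact ⟨z, hz, y, y', by rw [← hzq]; ring⟩
    · apply hcond
      obtain ⟨z, hz, hzq⟩ := exists_ne_zero_rank_two_form_eq (hΨ1 y) (hΨ1 y')
        (A := E) (B := -1) (l := (E - 1) * gp)
        (by rw [← hyc]; linear_combination -hqp) (by rw [← hyc]; nlinarith)
      exact ⟨z, hz, y, y', by rw [← hzq]; ring⟩
  · rintro ⟨hm, hp⟩ x x' z
    have hEc : E * cstar ≤ E * ‖inner ℂ (Ψ x) (Ψ x')‖ ^ 2 :=
      mul_le_mul_of_nonneg_left (hcle x x') (by linarith)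
    have hlp : E - 1 ≤ (E - 1) * gp := le_mul_of_one_le_right (by linarith) hgp1
    have hlm : (E - 1) * gm ≤ 0 := mul_nonpos_of_nonneg_of_nonpos (by linarith) hgm0
    have hlower : (E - 1) * gm * ‖z‖ ^ 2
        ≤ E * ‖inner ℂ (Ψ x) z‖ ^ 2 - ‖inner ℂ (Ψ x') z‖ ^ 2 := by
      have := norm_inner_sq_le_of_overlap (hΨ1 x) (hΨ1 x') (A := E) (ν := -((E - 1) * gm))
        (by linarith) (by linarith) (by linarith) (by linarith) z
      linarith
    have hupper : E * ‖inner ℂ (Ψ x) z‖ ^ 2 - ‖inner ℂ (Ψ x') z‖ ^ 2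
        ≤ (E - 1) * gp * ‖z‖ ^ 2 := by
      have hE0 : 0 < E := by linarith
      rw [← norm_inner_symm] at hEc
      have := norm_inner_sq_le_of_overlap (hΨ1 x') (hΨ1 x) (A := 1 / E)
        (ν := (E - 1) * gp / E) (by positivity) (div_nonneg (by linarith) hE0.le)
        (by rw [← add_div, le_div_iff₀ hE0]; linarith)
        (by
          refine le_of_mul_le_mul_left ?_ (pow_pos hE0 2)
          have h1 (c : ℝ) : E ^ 2 * ((E - 1) * gp / E + (1 - c) * (1 / E))
              = E * ((E - 1) * gp) + E * (1 - c) := by field_simp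
          have h2 : E ^ 2 * ((E - 1) * gp / E * (1 / E + (E - 1) * gp / E))
              = (E - 1) * gp + ((E - 1) * gp) ^ 2 := by field_simp
          rw [h1, h2]
          linarith) z
      have h3 := mul_le_mul_of_nonneg_left this hE0.le
      have h4 (P N : ℝ) : E * (1 / E * P + (E - 1) * gp / E * N) = P + (E - 1) * gp * N := by
        field_simp
      rw [h4] at h3
      linarith
    have hN : 0 ≤ (E - 1) * ‖z‖ ^ 2 := mul_nonneg (by linarith) (sq_nonneg _)
    rcases le_total 0 (1 - μ) with ht | ht
    · linear_combination mul_le_mul_of_nonneg_left hlower ht + mul_nonneg hN hm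
    · linear_combination mul_le_mul_of_nonpos_left hupper ht + mul_nonneg hN hp
end

section
/- Let d ≥ 2 be an integer, μ ∈ [0, d/(d−1)], and let ψ, φ be unit vectors in ℂ^d with c = |⟨ψ, φ⟩|². Set a = μ/d and b = μ/d + 1 − μ (so a, b ≥ 0). For s ∈ [0,1] define the matrices A(s) = a^s·I_d + (b^s − a^s)·|ψ⟩⟨ψ| and B(s) = a^s·I_d + (b^s − a^s)·|φ⟩⟨φ|. Then inf_{s ∈ [0,1]} Tr(A(s)·B(1−s)) = c + ((1−c)/d)·((d−2)μ + 2√(μ(d−(d−1)μ))). -/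
/-- The trace of a product of two matrices of the form `x • 1 + y • |ψ⟩⟨ψ|`, for unit vectors. -/
theorem re_trace_mul_smul_one_add_smul_outer {n : Type*} [Fintype n] [DecidableEq n]
    (ψ φ : n → ℂ) (hψ : ∑ i, Complex.normSq (ψ i) = 1) (hφ : ∑ i, Complex.normSq (φ i) = 1)
    (x y z w : ℝ) :
    (Matrix.trace (((x : ℂ) • (1 : Matrix n n ℂ)
        + (y : ℂ) • Matrix.of (fun i j => ψ i * star (ψ j)))
      * ((z : ℂ) • (1 : Matrix n n ℂ) + (w : ℂ) • Matrix.of (fun i j => φ i * star (φ j))))).re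
      = Fintype.card n * (x * z) + x * w + y * z
        + y * w * Complex.normSq (∑ i, star (ψ i) * φ i) := by
  have trace_one : ∀ v : n → ℂ, ∑ i, Complex.normSq (v i) = 1 →
      Matrix.trace (Matrix.of (fun i j => v i * star (v j))) = 1 := by
    intro v hv
    simp only [Matrix.trace, Matrix.diag, Matrix.of_apply, Complex.star_def, Complex.mul_conj]
    exact_mod_cast hv
  have trace_mul : Matrix.trace (Matrix.of (fun i j => ψ i * star (ψ j))
      * Matrix.of (fun i j => φ i * star (φ j)))
      = (Complex.normSq (∑ i, star (ψ i) * φ i) : ℂ) := by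
    rw [← Complex.mul_conj, map_sum, mul_comm, Finset.sum_mul_sum]
    simp only [Matrix.trace, Matrix.diag, Matrix.mul_apply, Matrix.of_apply]
    refine Finset.sum_congr rfl fun i _ => Finset.sum_congr rfl fun j _ => ?_
    simp only [Complex.star_def, map_mul, Complex.conj_conj]
    ring
  simp only [add_mul, mul_add, smul_mul_assoc, mul_smul_comm, one_mul, mul_one,
    Matrix.trace_add, Matrix.trace_smul, Matrix.trace_one, trace_one ψ hψ, trace_one φ hφ,
    trace_mul, smul_eq_mul]
  norm_cast
  ring

/-- Cauchy–Schwarz for unit vectors, in terms of `Complex.normSq`. -/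
theorem normSq_sum_star_mul_le_one {n : Type*} [Fintype n] (ψ φ : n → ℂ)
    (hψ : ∑ i, Complex.normSq (ψ i) = 1) (hφ : ∑ i, Complex.normSq (φ i) = 1) :
    Complex.normSq (∑ i, star (ψ i) * φ i) ≤ 1 := by
  simp only [Complex.normSq_eq_norm_sq] at *
  calc ‖∑ i, star (ψ i) * φ i‖ ^ 2 ≤ (∑ i, ‖ψ i‖ * ‖φ i‖) ^ 2 := by
        gcongr
        exact (norm_sum_le _ _).trans_eq (by simp)
    _ ≤ (∑ i, ‖ψ i‖ ^ 2) * ∑ i, ‖φ i‖ ^ 2 := Finset.sum_mul_sq_le_sq_mul_sq _ _ _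
    _ = 1 := by rw [hψ, hφ, one_mul]

theorem rpow_mul_rpow_one_sub {a : ℝ} (ha : 0 ≤ a) (s : ℝ) : a ^ s * a ^ (1 - s) = a := by
  rw [← Real.rpow_add' ha (by simp), add_sub_cancel, Real.rpow_one]

/-- The weighted geometric means of `a` and `b` with weights `s` and `1 - s` sum to at least
twice the geometric mean. -/
theorem two_mul_sqrt_le_rpow_mul_rpow_add {a b : ℝ} (ha : 0 ≤ a) (hb : 0 ≤ b) (s : ℝ) :
    2 * √(a * b) ≤ a ^ s * b ^ (1 - s) + b ^ s * a ^ (1 - s) := by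
  have hX : 0 ≤ a ^ s * b ^ (1 - s) := by positivity
  have hY : 0 ≤ b ^ s * a ^ (1 - s) := by positivity
  have hXY : (a ^ s * b ^ (1 - s)) * (b ^ s * a ^ (1 - s)) = a * b := by
    linear_combination (b ^ s * b ^ (1 - s)) * rpow_mul_rpow_one_sub ha s
      + a * rpow_mul_rpow_one_sub hb s
  rw [← hXY, Real.sqrt_mul hX]
  nlinarith [sq_nonneg (√(a ^ s * b ^ (1 - s)) - √(b ^ s * a ^ (1 - s))),
    Real.sq_sqrt hX, Real.sq_sqrt hY]

/-- For the depolarized pure-state mechanism, the Chernoff quantity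
`inf_{s∈[0,1]} Tr(A(s) B(1-s))` equals `c + ((1-c)/d)((d-2)μ + 2√(μ(d-(d-1)μ)))`,
where `A(s), B(1-s)` are the `s`-th and `(1-s)`-th powers of the two states. -/
theorem stmt_1 (d : ℕ) (hd : 2 ≤ d) (μ : ℝ)
    (hμ : μ ∈ Set.Icc (0 : ℝ) ((d : ℝ) / ((d : ℝ) - 1)))
    (ψ φ : Fin d → ℂ)
    (hψ : ∑ i, Complex.normSq (ψ i) = 1) (hφ : ∑ i, Complex.normSq (φ i) = 1)
    (c : ℝ) (hc : c = Complex.normSq (∑ i, star (ψ i) * φ i))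
    (a b : ℝ) (ha : a = μ / d) (hb : b = μ / d + 1 - μ)
    (A B : ℝ → Matrix (Fin d) (Fin d) ℂ)
    (hA : ∀ s : ℝ, A s = ((a ^ s : ℝ) : ℂ) • (1 : Matrix (Fin d) (Fin d) ℂ)
      + ((b ^ s - a ^ s : ℝ) : ℂ) • Matrix.of (fun i j => ψ i * star (ψ j)))
    (hB : ∀ s : ℝ, B s = ((a ^ s : ℝ) : ℂ) • (1 : Matrix (Fin d) (Fin d) ℂ)
      + ((b ^ s - a ^ s : ℝ) : ℂ) • Matrix.of (fun i j => φ i * star (φ j))) :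
    sInf ((fun s : ℝ => (Matrix.trace (A s * B (1 - s))).re) '' Set.Icc (0 : ℝ) 1)
      = c + ((1 - c) / d) * (((d : ℝ) - 2) * μ
        + 2 * Real.sqrt (μ * ((d : ℝ) - ((d : ℝ) - 1) * μ))) := by
  have hd0 : (2 : ℝ) ≤ d := by exact_mod_cast hd
  have hdpos : (0 : ℝ) < d := by linarith
  have hd1 : (0 : ℝ) < (d : ℝ) - 1 := by linarith
  obtain ⟨hμ0, hμ1⟩ := hμ
  have ha0 : 0 ≤ a := by rw [ha]; positivity
  have hda : (d : ℝ) * a = μ := by rw [ha]; field_simp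
  have hab : ((d : ℝ) - 1) * a + b = 1 := by rw [hb, ← ha]; linear_combination hda
  have hb0 : 0 ≤ b := by
    rw [le_div_iff₀ hd1] at hμ1
    have h : 0 ≤ (d : ℝ) * b := by nlinarith
    exact nonneg_of_mul_nonneg_right h hdpos
  have hc1 : c ≤ 1 := hc ▸ normSq_sum_star_mul_le_one ψ φ hψ hφ
  have hsqrt : √(μ * ((d : ℝ) - ((d : ℝ) - 1) * μ)) = d * √(a * b) := by
    have h : μ * ((d : ℝ) - ((d : ℝ) - 1) * μ) = (d : ℝ) ^ 2 * (a * b) := by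
      rw [← hda]
      linear_combination -(d : ℝ) ^ 2 * a * hab
    rw [h, Real.sqrt_mul (sq_nonneg _), Real.sqrt_sq hdpos.le]
  have hrhs : c + ((1 - c) / d) * (((d : ℝ) - 2) * μ
      + 2 * √(μ * ((d : ℝ) - ((d : ℝ) - 1) * μ)))
      = c + (1 - c) * (((d : ℝ) - 2) * a + 2 * √(a * b)) := by
    rw [hsqrt, ← hda]
    field_simp
  have htrace : ∀ s : ℝ, (Matrix.trace (A s * B (1 - s))).re
      = c + (1 - c) * (((d : ℝ) - 2) * a + (a ^ s * b ^ (1 - s) + b ^ s * a ^ (1 - s))) := by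
    intro s
    rw [hA, hB, re_trace_mul_smul_one_add_smul_outer ψ φ hψ hφ, ← hc, Fintype.card_fin]
    linear_combination ((d : ℝ) - 2 + c) * rpow_mul_rpow_one_sub ha0 s
      + c * rpow_mul_rpow_one_sub hb0 s + c * hab
  rw [hrhs]
  refine IsLeast.csInf_eq ⟨⟨1 / 2, by norm_num, ?_⟩, ?_⟩
  · have hhalf : (1 : ℝ) - 1 / 2 = 1 / 2 := by norm_num
    simp only [htrace]
    rw [hhalf, ← Real.sqrt_eq_rpow, ← Real.sqrt_eq_rpow, Real.sqrt_mul ha0]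
    ring
  · rintro _ ⟨s, -, rfl⟩
    simp only [htrace]
    have h1c : 0 ≤ 1 - c := by linarith
    gcongr
    exact two_mul_sqrt_le_rpow_mul_rpow_add ha0 hb0 s
end

section
/- Let d ≥ 2 be an integer. The function h(μ) = ((d−2)μ + 2√(μ(d−(d−1)μ)))/d is concave on the interval [0, d/(d−1)], satisfies h(μ) ≤ 1 for all μ in this interval, and attains the value 1 at μ = 1. -/
/-- The square root of a nonnegative concave function is concave. -/
theorem ConcaveOn.real_sqrt {E : Type*} [AddCommMonoid E] [Module ℝ E] {s : Set E} {f : E → ℝ}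
    (hf : ConcaveOn ℝ s f) (hf₀ : ∀ x ∈ s, 0 ≤ f x) :
    ConcaveOn ℝ s fun x => Real.sqrt (f x) :=
  ⟨hf.1, fun _ hx _ hy _ _ ha hb hab =>
    (Real.strictConcaveOn_sqrt.concaveOn.2 (hf₀ _ hx) (hf₀ _ hy) ha hb hab).trans
      (Real.sqrt_le_sqrt (hf.2 hx hy ha hb hab))⟩

/-- The parabola `x ↦ x (p - q x)` with `0 ≤ q` is concave. -/
theorem concaveOn_mul_sub_mul {p q : ℝ} (hq : 0 ≤ q) {s : Set ℝ} (hs : Convex ℝ s) :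
    ConcaveOn ℝ s fun x : ℝ => x * (p - q * x) := by
  refine ⟨hs, fun x _ y _ a b ha hb hab => ?_⟩
  obtain rfl : b = 1 - a := by linarith
  simp only [smul_eq_mul]
  have h : 0 ≤ q * (a * (1 - a)) * (x - y) ^ 2 := by positivity
  linarith

/-- The function `h(μ) = ((d-2)μ + 2√(μ(d-(d-1)μ)))/d` is concave on
`[0, d/(d-1)]`, is at most `1` on this interval, and equals `1` at `μ = 1`. -/
theorem stmt_2 (d : ℕ) (hd : 2 ≤ d) :
    ConcaveOn ℝ (Set.Icc (0 : ℝ) ((d : ℝ) / ((d : ℝ) - 1)))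
      (fun μ : ℝ => (((d : ℝ) - 2) * μ
        + 2 * Real.sqrt (μ * ((d : ℝ) - ((d : ℝ) - 1) * μ))) / d) ∧
    (∀ μ ∈ Set.Icc (0 : ℝ) ((d : ℝ) / ((d : ℝ) - 1)),
      (((d : ℝ) - 2) * μ + 2 * Real.sqrt (μ * ((d : ℝ) - ((d : ℝ) - 1) * μ))) / d ≤ 1) ∧
    (((d : ℝ) - 2) * 1 + 2 * Real.sqrt (1 * ((d : ℝ) - ((d : ℝ) - 1) * 1))) / d = 1 := by
  have hd' : (2 : ℝ) ≤ d := by exact_mod_cast hd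
  have hd₀ : (0 : ℝ) < d := by linarith
  have hd₁ : (0 : ℝ) < (d : ℝ) - 1 := by linarith
  have hfac : ∀ μ ∈ Set.Icc (0 : ℝ) ((d : ℝ) / ((d : ℝ) - 1)),
      0 ≤ (d : ℝ) - ((d : ℝ) - 1) * μ := by
    rintro μ ⟨-, hμ⟩
    rw [le_div_iff₀ hd₁] at hμ
    linarith
  refine ⟨?_, fun μ hμ => ?_, ?_⟩
  · have hsqrt := (concaveOn_mul_sub_mul (p := d) hd₁.le
      (convex_Icc (0 : ℝ) ((d : ℝ) / ((d : ℝ) - 1)))).real_sqrt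
      fun μ hμ => mul_nonneg hμ.1 (hfac μ hμ)
    have hlin := (concaveOn_id (𝕜 := ℝ)
      (convex_Icc (0 : ℝ) ((d : ℝ) / ((d : ℝ) - 1)))).smul (sub_nonneg.2 hd')
    have h := (hlin.add (hsqrt.smul zero_le_two)).smul (inv_nonneg.2 hd₀.le)
    refine h.congr fun μ _ => ?_
    simp only [Pi.add_apply, smul_eq_mul, id_eq]
    ring
  · rw [div_le_one hd₀]
    have hsqrt : Real.sqrt (μ * ((d : ℝ) - ((d : ℝ) - 1) * μ))
        ≤ (μ + ((d : ℝ) - ((d : ℝ) - 1) * μ)) / 2 := by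
      refine Real.sqrt_le_iff.2 ⟨by linarith [hμ.1, hfac μ hμ], ?_⟩
      linarith [sq_nonneg (μ - ((d : ℝ) - ((d : ℝ) - 1) * μ))]
    linarith
  · have h : (1 : ℝ) * ((d : ℝ) - ((d : ℝ) - 1) * 1) = 1 := by ring
    rw [h, Real.sqrt_one, div_eq_one_iff_eq hd₀.ne']
    ring
end

section
/- Let d ≥ 2 be an integer and α ≥ 0 a real number. Define μ₁ = dα/(dα + 1) and μ₂ = d(1+α)/(dα + d − 1). Then (d−2)μ₁ + 2√(μ₁(d − (d−1)μ₁)) ≤ (d−2)μ₂ + 2√(μ₂(d − (d−1)μ₂)). -/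
/-- For `d ≥ 2` and `α ≥ 0`, with `μ₁ = dα/(dα+1)` and
`μ₂ = d(1+α)/(dα+d-1)`, we have
`(d-2)μ₁ + 2√(μ₁(d-(d-1)μ₁)) ≤ (d-2)μ₂ + 2√(μ₂(d-(d-1)μ₂))`. -/
theorem stmt_3 (d : ℕ) (hd : 2 ≤ d) (α : ℝ) (hα : 0 ≤ α)
    (μ₁ μ₂ : ℝ)
    (hμ₁ : μ₁ = (d : ℝ) * α / ((d : ℝ) * α + 1))
    (hμ₂ : μ₂ = (d : ℝ) * (1 + α) / ((d : ℝ) * α + (d : ℝ) - 1)) :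
    ((d : ℝ) - 2) * μ₁ + 2 * Real.sqrt (μ₁ * ((d : ℝ) - ((d : ℝ) - 1) * μ₁)) ≤
    ((d : ℝ) - 2) * μ₂ + 2 * Real.sqrt (μ₂ * ((d : ℝ) - ((d : ℝ) - 1) * μ₂)) := by
  have hd' : (2 : ℝ) ≤ d := by exact_mod_cast hd
  have hA : 0 < (d : ℝ) * α + 1 := by positivity
  have hB : 0 < (d : ℝ) * α + d - 1 := by
    have : 0 ≤ (d : ℝ) * α := by positivity
    linarith
  have hB' : (d : ℝ) * (α + 1) - 1 ≠ 0 := ne_of_gt (by linarith)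
  set s := Real.sqrt (α * (1 + α))
  have hs0 : 0 ≤ s := Real.sqrt_nonneg _
  have hs2 : s ^ 2 = α * (1 + α) := Real.sq_sqrt (by positivity)
  have hsle : 2 * s ≤ 2 * α + 1 := by nlinarith
  have hsqrt₁ : Real.sqrt (μ₁ * ((d : ℝ) - ((d : ℝ) - 1) * μ₁)) = d * s / (d * α + 1) := by
    rw [show μ₁ * ((d : ℝ) - ((d : ℝ) - 1) * μ₁) = (d * s / (d * α + 1)) ^ 2 by
      rw [div_pow, mul_pow, hs2, hμ₁]
      field_simp
      ring]
    exact Real.sqrt_sq (by positivity)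
  have hsqrt₂ : Real.sqrt (μ₂ * ((d : ℝ) - ((d : ℝ) - 1) * μ₂)) = d * s / (d * α + d - 1) := by
    rw [show μ₂ * ((d : ℝ) - ((d : ℝ) - 1) * μ₂) = (d * s / (d * α + d - 1)) ^ 2 by
      rw [div_pow, mul_pow, hs2, hμ₂]
      field_simp
      ring]
    exact Real.sqrt_sq (by positivity)
  rw [hsqrt₁, hsqrt₂, hμ₁, hμ₂, ← sub_nonneg]
  have hdiff : ((d : ℝ) - 2) * (d * (1 + α) / (d * α + d - 1)) + 2 * (d * s / (d * α + d - 1)) -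
      ((d - 2) * (d * α / (d * α + 1)) + 2 * (d * s / (d * α + 1))) =
      d * ((d - 2) * (2 * α + 1 - 2 * s)) / ((d * α + 1) * (d * α + d - 1)) := by
    field_simp
    ring
  rw [hdiff]
  have h₁ : 0 ≤ (d : ℝ) - 2 := by linarith
  have h₂ : 0 ≤ 2 * α + 1 - 2 * s := by linarith
  positivity
end

section
/- Let d ≥ 2 be an integer and let c_*, c^* be reals with 0 ≤ c_* ≤ c^* ≤ 1 and c_* < 1. For ε > 0 define g_*^−(ε) = (1 − √(1 + (1−c_*)/sinh²(ε/2)))/2, μ_*(ε) = d·g_*^−(ε)/(d·g_*^−(ε) − 1), and G(c, d, μ) = c + ((1−c)/d)·((d−2)μ + 2√(μ(d−(d−1)μ))). Then the function ε ↦ (−log G(c^*, d, μ_*(ε)))/ε² tends to (1 − c^*)/(4d(1 − c_*)) as ε → 0 from the right. -/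
open Filter Topology in
/-- If `f - 1` is asymptotic to `-L * w` with `f → 1`, then `-log f` is asymptotic to `L * w`. -/
theorem tendsto_neg_log_div {α : Type*} {l : Filter α} {f w : α → ℝ} {L : ℝ}
    (hf : Tendsto f l (𝓝 1)) (hL : Tendsto (fun x => (1 - f x) / w x) l (𝓝 L)) :
    Tendsto (fun x => -Real.log (f x) / w x) l (𝓝 L) := by
  have hc : ContinuousAt (dslope Real.log 1) 1 :=
    continuousAt_dslope_same.2 (Real.differentiableAt_log one_ne_zero)
  have h := hL.mul (hc.tendsto.comp hf)
  simp only [dslope_same, Real.deriv_log, inv_one, mul_one] at h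
  refine h.congr fun x => ?_
  have hx := sub_smul_dslope Real.log 1 (f x)
  simp only [smul_eq_mul, Real.log_one, sub_zero] at hx
  simp only [Function.comp_apply]
  rw [← hx]
  ring

open Filter Topology in
theorem tendsto_div_sinh_half :
    Tendsto (fun ε : ℝ => ε / Real.sinh (ε / 2)) (𝓝[>] 0) (𝓝 2) := by
  have hd : HasDerivAt (fun ε : ℝ => Real.sinh (ε / 2)) (1 / 2) 0 := by
    simpa using ((hasDerivAt_id (0 : ℝ)).div_const 2).sinh
  have h := (hd.tendsto_slope_zero_right).inv₀ (by norm_num)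
  simp only [zero_add, zero_div, Real.sinh_zero, sub_zero, smul_eq_mul] at h
  norm_num at h
  exact h.congr fun ε => by rw [mul_comm, ← div_eq_mul_inv]

open Filter Topology in
/-- The root `(1 - √(1 + a / sinh² (ε / 2))) / 2` is asymptotic to `-√a / ε` as `ε → 0⁺`. -/
theorem tendsto_mul_root_sinh (a : ℝ) :
    Tendsto (fun ε : ℝ => ε * ((1 - √(1 + a / Real.sinh (ε / 2) ^ 2)) / 2))
      (𝓝[>] 0) (𝓝 (-√a)) := by
  have hid : Tendsto (fun ε : ℝ => ε) (𝓝[>] 0) (𝓝 0) := nhdsWithin_le_nhds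
  have h := (hid.sub (((hid.pow 2).add
    ((tendsto_div_sinh_half.pow 2).const_mul a)).sqrt)).div_const 2
  have hlim : (0 - √(0 ^ 2 + a * 2 ^ 2)) / 2 = -√a := by
    rw [zero_pow two_ne_zero, zero_add, Real.sqrt_mul' _ (by positivity),
      Real.sqrt_sq zero_le_two]
    ring
  rw [hlim] at h
  refine h.congr' ?_
  filter_upwards [self_mem_nhdsWithin] with ε hε
  have hε : 0 < ε := hε
  have hs : √(ε ^ 2 + a * (ε / Real.sinh (ε / 2)) ^ 2)
      = ε * √(1 + a / Real.sinh (ε / 2) ^ 2) := by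
    rw [← Real.sqrt_sq hε.le, ← Real.sqrt_mul (sq_nonneg ε), Real.sqrt_sq hε.le]
    congr 1
    ring
  rw [hs]
  ring

/-- Rationalising the defect `d - ((d - 2) μ + 2 √(μ (d - (d - 1) μ)))` at `μ = 1 - ν`. -/
theorem sub_add_sqrt_eq_div {d ν : ℝ} (hd : 2 ≤ d) (h0 : 0 ≤ ν) (h1 : ν ≤ 1) :
    d - ((d - 2) * (1 - ν) + 2 * √((1 - ν) * (d - (d - 1) * (1 - ν))))
      = d ^ 2 * ν ^ 2 /
        (2 + (d - 2) * ν + 2 * √((1 - ν) * (d - (d - 1) * (1 - ν)))) := by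
  have hA : 0 ≤ (d - 2) * ν := mul_nonneg (by linarith) h0
  have hnn : 0 ≤ (1 - ν) * (d - (d - 1) * (1 - ν)) :=
    mul_nonneg (by linarith) (by nlinarith)
  have hs := Real.sq_sqrt hnn
  have hs0 := Real.sqrt_nonneg ((1 - ν) * (d - (d - 1) * (1 - ν)))
  rw [eq_div_iff (by positivity)]
  linear_combination (-4) * hs

open Filter Topology in
/-- As `ε → 0⁺`, `(-log G(c^*, d, μ_*(ε)))/ε²` tends to
`(1 - c^*)/(4d(1 - c_*))`. -/
theorem stmt_4 (d : ℕ) (hd : 2 ≤ d) (cs cS : ℝ)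
    (h1 : 0 ≤ cs) (h2 : cs ≤ cS) (h3 : cS ≤ 1) (h4 : cs < 1)
    (g μst : ℝ → ℝ)
    (hg : ∀ ε : ℝ, g ε = (1 - Real.sqrt (1 + (1 - cs) / Real.sinh (ε / 2) ^ 2)) / 2)
    (hμ : ∀ ε : ℝ, μst ε = (d : ℝ) * g ε / ((d : ℝ) * g ε - 1))
    (G : ℝ → ℝ)
    (hG : ∀ μ : ℝ, G μ = cS + ((1 - cS) / d) * (((d : ℝ) - 2) * μ
      + 2 * Real.sqrt (μ * ((d : ℝ) - ((d : ℝ) - 1) * μ)))) :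
    Filter.Tendsto (fun ε : ℝ => (-Real.log (G (μst ε))) / ε ^ 2)
      (nhdsWithin 0 (Set.Ioi 0))
      (nhds ((1 - cS) / (4 * d * (1 - cs)))) := by
  have hd2 : (2 : ℝ) ≤ d := by exact_mod_cast hd
  have hd0 : (0 : ℝ) < d := by linarith
  have ha : 0 < 1 - cs := by linarith
  have hg0 (ε : ℝ) : g ε ≤ 0 := by
    have : 1 ≤ √(1 + (1 - cs) / Real.sinh (ε / 2) ^ 2) :=
      Real.one_le_sqrt.2 (le_add_of_nonneg_right (by positivity))
    rw [hg]
    linarith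
  have hdg (ε : ℝ) : d * g ε ≤ 0 := mul_nonpos_of_nonneg_of_nonpos hd0.le (hg0 ε)
  set ν : ℝ → ℝ := fun ε => 1 / (1 - d * g ε) with hν
  have hμν (ε : ℝ) : μst ε = 1 - ν ε := by
    have h : 1 - d * g ε ≠ 0 := by linarith [hdg ε]
    have h' : d * g ε - 1 ≠ 0 := by linarith [hdg ε]
    rw [hμ, hν]
    field_simp
    ring
  have hν0 (ε : ℝ) : 0 ≤ ν ε := one_div_nonneg.2 (by linarith [hdg ε])
  have hν1 (ε : ℝ) : ν ε ≤ 1 := div_le_one_of_le₀ (by linarith [hdg ε]) (by linarith [hdg ε])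
  have hid : Tendsto (fun ε : ℝ => ε) (𝓝[>] 0) (𝓝 0) := nhdsWithin_le_nhds
  have hνε : Tendsto (fun ε => ν ε / ε) (𝓝[>] 0) (𝓝 (d * √(1 - cs))⁻¹) := by
    have h := (hid.sub ((tendsto_mul_root_sinh (1 - cs)).const_mul (d : ℝ))).inv₀
      (by rw [mul_neg, zero_sub, neg_neg]; positivity)
    rw [mul_neg, zero_sub, neg_neg] at h
    refine h.congr fun ε => ?_
    rw [← hg, hν, div_div, one_div]
    congr 1
    ring
  have hνlim : Tendsto ν (𝓝[>] 0) (𝓝 0) := by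
    have h := hνε.mul hid
    rw [mul_zero] at h
    refine h.congr' ?_
    filter_upwards [self_mem_nhdsWithin] with ε hε
    exact div_mul_cancel₀ _ (ne_of_gt hε)
  set D : ℝ → ℝ := fun x =>
    2 + (d - 2) * x + 2 * √((1 - x) * (d - (d - 1) * (1 - x))) with hD
  have hDlim : Tendsto (fun ε => D (ν ε)) (𝓝[>] 0) (𝓝 4) := by
    have hc : Continuous D := by fun_prop
    have h := (hc.tendsto 0).comp hνlim
    have h4 : D 0 = 4 := by norm_num [hD]
    rwa [h4] at h
  have hGsub (ε : ℝ) : 1 - G (μst ε) = (1 - cS) * d * ν ε ^ 2 / D (ν ε) := by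
    have h := sub_add_sqrt_eq_div hd2 (hν0 ε) (hν1 ε)
    have h' : (1 - cS) * d * ν ε ^ 2 / D (ν ε)
        = (1 - cS) / d * (d ^ 2 * ν ε ^ 2 / D (ν ε)) := by
      field_simp
    rw [h', hD, ← h, hG, hμν]
    field_simp
    ring
  refine tendsto_neg_log_div ?_ ?_
  · have h := (((hνlim.pow 2).const_mul ((1 - cS) * d)).div hDlim four_ne_zero).const_sub 1
    norm_num at h
    exact h.congr fun ε => by simp only [← hGsub, sub_sub_cancel]
  · have h := ((hνε.pow 2).const_mul ((1 - cS) * d)).div hDlim four_ne_zero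
    have hlim : (1 - cS) * d * (d * √(1 - cs))⁻¹ ^ 2 / 4 = (1 - cS) / (4 * d * (1 - cs)) := by
      rw [inv_pow, mul_pow, Real.sq_sqrt ha.le]
      field_simp
    rw [hlim] at h
    refine h.congr fun ε => ?_
    simp only [Pi.div_apply]
    rw [hGsub]
    ring
end

section
/- Let v ≥ 2 and b ≥ 1 be integers and ε > 0. For every ε-LDP mechanism q ∈ ℝ^{v×b} there exist a nonnegative vector ζ indexed by the subsets T ⊆ [v] and a row-stochastic matrix Φ (rows indexed by subsets of [v], columns by [b]) such that: (i) Σ_T S^{(v)}_{x,T} · ζ_T = 1 for every x ∈ [v], and (ii) q_{xy} = Σ_T S^{(v)}_{x,T} · ζ_T · Φ_{T,y} for all x ∈ [v], y ∈ [b]. In other words, q factors as an extremal ε-LDP mechanism followed by a classical post-processing channel. -/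
open Finset in
/-- The inclusion probabilities `t` of independent coordinates determine the average of the
two-valued weight of a random subset at each coordinate. -/
theorem sum_ite_mem_mul_prod_mul_prod_one_sub {ι : Type*} [Fintype ι] [DecidableEq ι]
    (a : ℝ) (t : ι → ℝ) (x : ι) :
    ∑ T : Finset ι, (if x ∈ T then a else 1) * ((∏ i ∈ T, t i) * ∏ i ∈ Tᶜ, (1 - t i)) =
      1 + (a - 1) * t x := by
  have h := Fintype.prod_add (fun i => t i * if i = x then a else 1) (fun i => 1 - t i)
  have hprod : ∏ i, (t i * (if i = x then a else 1) + (1 - t i)) = 1 + (a - 1) * t x := by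
    rw [Fintype.prod_eq_single x]
    · simp only [if_true]
      ring
    · intro i hi
      simp [hi]
  rw [← hprod, h]
  refine sum_congr rfl fun T _ => ?_
  rw [prod_mul_distrib, prod_ite_eq']
  ring

/-- A nonnegative vector whose entries are within a factor `a` of each other is a nonnegative
combination of vectors with entries in `{1, a}`. -/
theorem exists_nonneg_sum_ite_mem_mul_eq {ι : Type*} [Fintype ι] [DecidableEq ι] [Nonempty ι]
    {a : ℝ} (ha : 1 < a) (c : ι → ℝ) (hc : ∀ x, 0 ≤ c x) (hle : ∀ x x', c x ≤ a * c x') :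
    ∃ w : Finset ι → ℝ, (∀ T, 0 ≤ w T) ∧
      ∀ x, c x = ∑ T : Finset ι, (if x ∈ T then a else 1) * w T := by
  obtain ⟨x₀, hx₀⟩ := Finite.exists_min c
  have ha' : 0 < a - 1 := sub_pos.2 ha
  rcases (hc x₀).eq_or_lt with h0 | hpos
  · refine ⟨0, fun _ => le_rfl, fun x => ?_⟩
    have := hle x x₀
    rw [← h0, mul_zero] at this
    simpa using le_antisymm this (hc x)
  · have hd : 0 < c x₀ * (a - 1) := mul_pos hpos ha'
    let t : ι → ℝ := fun x => (c x - c x₀) / (c x₀ * (a - 1))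
    have ht0 : ∀ x, 0 ≤ t x := fun x => div_nonneg (sub_nonneg.2 (hx₀ x)) hd.le
    have ht1 : ∀ x, 0 ≤ 1 - t x := fun x =>
      sub_nonneg.2 ((div_le_one hd).2 (by linarith [hle x x₀]))
    refine ⟨fun T => c x₀ * ((∏ i ∈ T, t i) * ∏ i ∈ Tᶜ, (1 - t i)), fun T => ?_, fun x => ?_⟩
    · exact mul_nonneg hpos.le (mul_nonneg (Finset.prod_nonneg fun i _ => ht0 i)
        (Finset.prod_nonneg fun i _ => ht1 i))
    · simp_rw [mul_left_comm _ (c x₀)]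
      rw [← Finset.mul_sum, sum_ite_mem_mul_prod_mul_prod_one_sub]
      simp only [t]
      field_simp
      ring

/-- A nonnegative matrix is the product of its row sums with a row-stochastic matrix. -/
theorem exists_stochastic_sum_mul_eq {ι κ : Type*} [Fintype κ] [Nonempty κ]
    (w : ι → κ → ℝ) (hw : ∀ i k, 0 ≤ w i k) :
    ∃ Φ : ι → κ → ℝ, (∀ i k, 0 ≤ Φ i k) ∧ (∀ i, ∑ k, Φ i k = 1) ∧
      ∀ i k, (∑ k', w i k') * Φ i k = w i k := by
  suffices H : ∀ i, ∃ φ : κ → ℝ, (∀ k, 0 ≤ φ k) ∧ ∑ k, φ k = 1 ∧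
      ∀ k, (∑ k', w i k') * φ k = w i k by
    choose Φ h₁ h₂ h₃ using H
    exact ⟨Φ, h₁, h₂, h₃⟩
  intro i
  by_cases h : ∑ k', w i k' = 0
  · refine ⟨fun _ => (Fintype.card κ : ℝ)⁻¹, fun _ => by positivity, by simp, fun k => ?_⟩
    rw [h, zero_mul, (Finset.sum_eq_zero_iff_of_nonneg fun k _ => hw i k).1 h k
      (Finset.mem_univ k)]
  · refine ⟨fun k => w i k / ∑ k', w i k', fun k =>
      div_nonneg (hw i k) (Finset.sum_nonneg fun k _ => hw i k), ?_, fun k =>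
      mul_div_cancel₀ _ h⟩
    rw [← Finset.sum_div, div_self h]

/-- Every ε-LDP mechanism factors as an extremal ε-LDP mechanism
followed by a row-stochastic post-processing. -/
theorem stmt_5 (v b : ℕ) (hv : 2 ≤ v) (hb : 1 ≤ b) (ε : ℝ) (hε : 0 < ε)
    (q : Fin v → Fin b → ℝ)
    (hq_nonneg : ∀ x y, 0 ≤ q x y)
    (hq_row : ∀ x, ∑ y, q x y = 1)
    (hq_ldp : ∀ x x' y, q x y ≤ Real.exp ε * q x' y) :
    ∃ (ζ : Finset (Fin v) → ℝ) (Φ : Finset (Fin v) → Fin b → ℝ),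
      (∀ T, 0 ≤ ζ T) ∧
      (∀ T y, 0 ≤ Φ T y) ∧
      (∀ T, ∑ y, Φ T y = 1) ∧
      (∀ x : Fin v,
        ∑ T : Finset (Fin v), (if x ∈ T then Real.exp ε else 1) * ζ T = 1) ∧
      (∀ x y, q x y =
        ∑ T : Finset (Fin v), (if x ∈ T then Real.exp ε else 1) * ζ T * Φ T y) := by
  have : Nonempty (Fin v) := ⟨⟨0, by omega⟩⟩
  have : Nonempty (Fin b) := ⟨⟨0, by omega⟩⟩
  choose w hw hqw using fun y => exists_nonneg_sum_ite_mem_mul_eq (Real.one_lt_exp_iff.2 hε)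
    (fun x => q x y) (fun x => hq_nonneg x y) (fun x x' => hq_ldp x x' y)
  obtain ⟨Φ, hΦ, hΦ1, hwΦ⟩ := exists_stochastic_sum_mul_eq (fun T y => w y T) fun T y => hw y T
  refine ⟨fun T => ∑ y, w y T, Φ, fun T => Finset.sum_nonneg fun y _ => hw y T, hΦ, hΦ1,
    fun x => ?_, fun x y => ?_⟩
  · refine Eq.trans ?_ (hq_row x)
    simp_rw [Finset.mul_sum]
    rw [Finset.sum_comm]
    exact Finset.sum_congr rfl fun y _ => (hqw y x).symm
  · simp_rw [mul_assoc, hwΦ]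
    exact hqw y x
end

section
/- Let v ≥ 2 be an integer and ε > 0. Let θ be a nonnegative real vector indexed by the subsets T ⊆ [v] such that Σ_T S^{(v)}_{x,T}·θ_T = 1 for every x ∈ [v]. Then for all distinct h, h' ∈ [v], Σ_{T : h ∈ T, h' ∉ T} θ_T = Σ_{T : h ∉ T, h' ∈ T} θ_T. -/
/-- If `θ ≥ 0` satisfies `S^{(v)} θ = 𝟙`, then for all distinct
`h, h'`, `Σ_{T : h ∈ T, h' ∉ T} θ_T = Σ_{T : h ∉ T, h' ∈ T} θ_T`. -/
theorem stmt_6 (v : ℕ) (hv : 2 ≤ v) (ε : ℝ) (hε : 0 < ε)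
    (θ : Finset (Fin v) → ℝ) (hθ : ∀ T, 0 ≤ θ T)
    (hsum : ∀ x : Fin v,
      ∑ T : Finset (Fin v), (if x ∈ T then Real.exp ε else 1) * θ T = 1)
    (h h' : Fin v) (hne : h ≠ h') :
    ∑ T ∈ Finset.univ.filter (fun T : Finset (Fin v) => h ∈ T ∧ h' ∉ T), θ T =
    ∑ T ∈ Finset.univ.filter (fun T : Finset (Fin v) => h ∉ T ∧ h' ∈ T), θ T := by
  have hexp : Real.exp ε - 1 ≠ 0 := (sub_pos.mpr (Real.one_lt_exp_iff.mpr hε)).ne'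
  apply mul_left_cancel₀ hexp
  have hdiff := sub_eq_zero.mpr ((hsum h).trans (hsum h').symm)
  rw [← Finset.sum_sub_distrib] at hdiff
  rw [← sub_eq_zero, Finset.sum_filter, Finset.sum_filter, Finset.mul_sum, Finset.mul_sum,
    ← Finset.sum_sub_distrib]
  refine Eq.trans (Finset.sum_congr rfl fun T _ => ?_) hdiff
  by_cases h1 : h ∈ T <;> by_cases h2 : h' ∈ T <;> simp [h1, h2] <;> ring
end

section
/- Let v ≥ 2 be an integer and ε > 0. Let θ be a nonnegative real vector indexed by the subsets T ⊆ [v] such that Σ_T S^{(v)}_{x,T}·θ_T = 1 for every x ∈ [v]. Then for all distinct h, h' ∈ [v], inf_{s ∈ [0,1]} Σ_T θ_T · (S^{(v)}_{h,T})^s · (S^{(v)}_{h',T})^{1−s} = Σ_T θ_T · √(S^{(v)}_{h,T} · S^{(v)}_{h',T}); that is, the infimum over s ∈ [0,1] is attained at s = 1/2. -/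
/-- AM-GM for the two weighted geometric means with exchanged weights. -/
theorem two_mul_sqrt_mul_le_rpow_mul_rpow_add {a b : ℝ} (ha : 0 < a) (hb : 0 < b) (s : ℝ) :
    2 * Real.sqrt (a * b) ≤ a ^ s * b ^ (1 - s) + a ^ (1 - s) * b ^ s := by
  have hp : 0 < a ^ s * b ^ (1 - s) := by positivity
  have hq : 0 < a ^ (1 - s) * b ^ s := by positivity
  have hpq : a * b = (a ^ s * b ^ (1 - s)) * (a ^ (1 - s) * b ^ s) := by
    have h1 : a ^ s * a ^ (1 - s) = a := by
      rw [← Real.rpow_add ha, add_sub_cancel, Real.rpow_one]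
    have h2 : b ^ s * b ^ (1 - s) = b := by
      rw [← Real.rpow_add hb, add_sub_cancel, Real.rpow_one]
    linear_combination -h1 * (b ^ s * b ^ (1 - s)) - a * h2
  rw [hpq, Real.sqrt_mul hp.le]
  nlinarith [sq_nonneg (√(a ^ s * b ^ (1 - s)) - √(a ^ (1 - s) * b ^ s)),
    Real.sq_sqrt hp.le, Real.sq_sqrt hq.le]

/-- For numbers in `{1, c}`, exchanging the exponents changes a weighted geometric mean by a fixed
multiple of the difference of the two numbers. -/
theorem rpow_mul_rpow_sub_swap_ite {c : ℝ} (hc : c ≠ 1) (s : ℝ) (P Q : Prop)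
    [Decidable P] [Decidable Q] :
    (if P then c else 1) ^ s * (if Q then c else 1) ^ (1 - s)
        - (if P then c else 1) ^ (1 - s) * (if Q then c else 1) ^ s =
      (c ^ s - c ^ (1 - s)) / (c - 1) * ((if P then c else 1) - (if Q then c else 1)) := by
  have hc' : c - 1 ≠ 0 := sub_ne_zero.mpr hc
  split_ifs
  · ring
  · simp [hc']
  · rw [← neg_sub c 1, mul_neg, div_mul_cancel₀ _ hc']
    simp
  · simp

/-- For an extremal mechanism given by `θ`, the infimum over
`s ∈ [0,1]` of `Σ_T θ_T (S_{h,T})^s (S_{h',T})^{1-s}` is attained at `s = 1/2`,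
i.e. it equals `Σ_T θ_T √(S_{h,T} S_{h',T})`. -/
theorem stmt_7 (v : ℕ) (hv : 2 ≤ v) (ε : ℝ) (hε : 0 < ε)
    (θ : Finset (Fin v) → ℝ) (hθ : ∀ T, 0 ≤ θ T)
    (hsum : ∀ x : Fin v,
      ∑ T : Finset (Fin v), (if x ∈ T then Real.exp ε else 1) * θ T = 1)
    (h h' : Fin v) (hne : h ≠ h') :
    sInf ((fun s : ℝ => ∑ T : Finset (Fin v),
        θ T * (if h ∈ T then Real.exp ε else 1) ^ s
            * (if h' ∈ T then Real.exp ε else 1) ^ (1 - s)) '' Set.Icc (0 : ℝ) 1) =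
      ∑ T : Finset (Fin v),
        θ T * Real.sqrt ((if h ∈ T then Real.exp ε else 1)
          * (if h' ∈ T then Real.exp ε else 1)) := by
  have hc : Real.exp ε ≠ 1 := (Real.one_lt_exp_iff.mpr hε).ne'
  have hpos : ∀ (x : Fin v) (T : Finset (Fin v)),
      (0 : ℝ) < if x ∈ T then Real.exp ε else 1 := by
    intro x T
    split_ifs <;> positivity
  refine IsLeast.csInf_eq ⟨⟨1 / 2, by norm_num, ?_⟩, ?_⟩
  · refine Finset.sum_congr rfl fun T _ => ?_
    rw [Real.sqrt_mul (hpos h T).le, Real.sqrt_eq_rpow, Real.sqrt_eq_rpow, mul_assoc]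
    norm_num
  · rintro _ ⟨s, -, rfl⟩
    have hdiff : ∑ T : Finset (Fin v), θ T *
        ((if h ∈ T then Real.exp ε else 1) - (if h' ∈ T then Real.exp ε else 1)) = 0 := by
      rw [← sub_eq_zero.mpr ((hsum h).trans (hsum h').symm), ← Finset.sum_sub_distrib]
      exact Finset.sum_congr rfl fun T _ => by ring
    have hle : ∑ T : Finset (Fin v), (2 * (θ T * Real.sqrt ((if h ∈ T then Real.exp ε else 1)
          * (if h' ∈ T then Real.exp ε else 1)))
        + (Real.exp ε ^ s - Real.exp ε ^ (1 - s)) / (Real.exp ε - 1) * (θ T *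
          ((if h ∈ T then Real.exp ε else 1) - (if h' ∈ T then Real.exp ε else 1)))) ≤
        ∑ T : Finset (Fin v), 2 * (θ T * (if h ∈ T then Real.exp ε else 1) ^ s
            * (if h' ∈ T then Real.exp ε else 1) ^ (1 - s)) := by
      refine Finset.sum_le_sum fun T _ => ?_
      have h1 := mul_le_mul_of_nonneg_left
        (two_mul_sqrt_mul_le_rpow_mul_rpow_add (hpos h T) (hpos h' T) s) (hθ T)
      have h2 := congrArg (θ T * ·) (rpow_mul_rpow_sub_swap_ite hc s (h ∈ T) (h' ∈ T))
      linarith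
    rw [Finset.sum_add_distrib, ← Finset.mul_sum, ← Finset.mul_sum, ← Finset.mul_sum, hdiff,
      mul_zero, add_zero] at hle
    exact le_of_mul_le_mul_left hle two_pos
end

section
/- Let v ≥ 2 be an integer and ε > 0. Let θ be a nonnegative real vector indexed by the subsets T ⊆ [v] such that Σ_T S^{(v)}_{x,T}·θ_T = 1 for every x ∈ [v]. Then Σ_T θ_T · ((|T|·e^{ε/2} + v − |T|)² − (|T|·e^ε + v − |T|)) ≥ min_{k ∈ {0,1,…,v}} ((k·e^{ε/2} + v − k)² − (k·e^ε + v − k)) / f(v,k,ε), where f(v,k,ε) = (k·e^ε + v − k)/v. -/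
lemma sum_ite_mem_one {v : ℕ} (a : ℝ) (T : Finset (Fin v)) :
    ∑ x : Fin v, (if x ∈ T then a else 1) = (T.card : ℝ) * a + v - T.card := by
  have h : ∀ x : Fin v, (if x ∈ T then a else 1) = (if x ∈ T then a - 1 else 0) + 1 := by
    intro x
    split_ifs <;> ring
  simp only [h, Finset.sum_add_distrib, Finset.sum_ite_mem, Finset.univ_inter,
    Finset.sum_const, Finset.card_univ, Fintype.card_fin, nsmul_eq_mul]
  ring

/-- If the weights `θ T * w T` sum to one, the sum of `θ T * g T` is at least any lower bound
of the ratios `g T / w T`. -/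
lemma le_sum_mul_of_le_div {ι : Type*} [Fintype ι] {θ g w : ι → ℝ} {m : ℝ}
    (hθ : ∀ i, 0 ≤ θ i) (hw : ∀ i, 0 < w i) (hsum : ∑ i, θ i * w i = 1)
    (hm : ∀ i, m ≤ g i / w i) : m ≤ ∑ i, θ i * g i := by
  calc m = ∑ i, θ i * (m * w i) := by
        simp_rw [mul_left_comm _ m]
        rw [← Finset.mul_sum, hsum, mul_one]
    _ ≤ ∑ i, θ i * g i := Finset.sum_le_sum fun i _ =>
        mul_le_mul_of_nonneg_left ((le_div_iff₀ (hw i)).1 (hm i)) (hθ i)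

/-- For an extremal mechanism given by `θ`,
`Σ_T θ_T ((|T| e^{ε/2} + v - |T|)² - (|T| e^ε + v - |T|))` is at least the
minimum over `k ∈ {0,…,v}` of `((k e^{ε/2} + v - k)² - (k e^ε + v - k)) / f(v,k,ε)`,
where `f(v,k,ε) = (k e^ε + v - k)/v`. -/
theorem stmt_8 (v : ℕ) (hv : 2 ≤ v) (ε : ℝ) (hε : 0 < ε)
    (θ : Finset (Fin v) → ℝ) (hθ : ∀ T, 0 ≤ θ T)
    (hsum : ∀ x : Fin v,
      ∑ T : Finset (Fin v), (if x ∈ T then Real.exp ε else 1) * θ T = 1) :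
    ∑ T : Finset (Fin v), θ T *
        (((T.card : ℝ) * Real.exp (ε / 2) + (v : ℝ) - T.card) ^ 2
          - ((T.card : ℝ) * Real.exp ε + (v : ℝ) - T.card)) ≥
      ⨅ k : Fin (v + 1),
        (((k.1 : ℝ) * Real.exp (ε / 2) + (v : ℝ) - k.1) ^ 2
            - ((k.1 : ℝ) * Real.exp ε + (v : ℝ) - k.1)) /
          (((k.1 : ℝ) * Real.exp ε + (v : ℝ) - k.1) / v) := by
  have hv0 : (0 : ℝ) < v := by exact_mod_cast (by omega : 0 < v)
  have hcard : ∀ T : Finset (Fin v), T.card ≤ v := fun T => by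
    simpa using Finset.card_le_univ T
  refine le_sum_mul_of_le_div
    (w := fun T => ((T.card : ℝ) * Real.exp ε + (v : ℝ) - T.card) / v) hθ ?_ ?_ ?_
  · intro T
    have hexp : 1 < Real.exp ε := Real.one_lt_exp_iff.2 hε
    have hT : (0 : ℝ) ≤ T.card := Nat.cast_nonneg _
    exact div_pos (by nlinarith) hv0
  · have htotal : ∑ T : Finset (Fin v), θ T *
        ((T.card : ℝ) * Real.exp ε + (v : ℝ) - T.card) = v := by
      simp_rw [← sum_ite_mem_one, Finset.mul_sum, mul_comm (θ _)]
      rw [Finset.sum_comm]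
      simp only [hsum, Finset.sum_const, Finset.card_univ, Fintype.card_fin, nsmul_eq_mul, mul_one]
    simp_rw [← mul_div_assoc]
    rw [← Finset.sum_div, htotal, div_self hv0.ne']
  · intro T
    exact ciInf_le (Set.finite_range _).bddBelow
      (⟨T.card, Nat.lt_succ_of_le (hcard T)⟩ : Fin (v + 1))
end

section
/- Let v ≥ 2 and b ≥ 1 be integers, ε > 0, and η ∈ (0, 1]. For every ε-LDP mechanism q ∈ ℝ^{v×b}, min over h ∈ [v] of D(q̃_{h,η} ‖ q̃_0) ≤ (1/v) · max_{k ∈ {0,1,…,v}} F(v,k,ε,η)/f(v,k,ε), where f(v,k,ε) = (k·e^ε + v − k)/v, Δ₁ = η·e^ε + (1−η)·f(v,k,ε), Δ₂ = η + (1−η)·f(v,k,ε), L(x) = x·log x, and F(v,k,ε,η) = k·L(Δ₁) + (v−k)·L(Δ₂) − v·L(f(v,k,ε)). -/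
/-- `f(v,k,ε) = (k e^ε + v - k)/v`. -/
noncomputable def fPUT (v k ε : ℝ) : ℝ := (k * Real.exp ε + v - k) / v

/-- `L(x) = x log x`. -/
noncomputable def LPUT (x : ℝ) : ℝ := x * Real.log x

/-- `F(v,k,ε,η) = k L(Δ₁) + (v-k) L(Δ₂) - v L(f(v,k,ε))` where
`Δ₁ = η e^ε + (1-η) f(v,k,ε)` and `Δ₂ = η + (1-η) f(v,k,ε)`. -/
noncomputable def FPUT (v k ε η : ℝ) : ℝ :=
  k * LPUT (η * Real.exp ε + (1 - η) * fPUT v k ε)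
    + (v - k) * LPUT (η + (1 - η) * fPUT v k ε)
    - v * LPUT (fPUT v k ε)

/-- Tangent-plane bound for the relative entropy integrand `x log (x / m)`. -/
theorem mul_log_div_tangent_le {x m s : ℝ} (hx : 0 < x) (hm : 0 < m) (hs : 0 < s) :
    x * Real.log s + x - m * s ≤ x * Real.log (x / m) := by
  have h := Real.log_le_sub_one_of_pos (div_pos (mul_pos hm hs) hx)
  rw [Real.log_div (mul_pos hm hs).ne' hx.ne', Real.log_mul hm.ne' hs.ne'] at h
  rw [Real.log_div hx.ne' hm.ne']
  have h' := mul_le_mul_of_nonneg_left h hx.le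
  have e : x * (m * s / x - 1) = m * s - x := by field_simp
  rw [e] at h'
  linarith

/-- The relative entropy integrand `x log (x / m)` is jointly convex on positive pairs. -/
theorem convexOn_mul_log_div :
    ConvexOn ℝ (Set.Ioi (0 : ℝ) ×ˢ Set.Ioi (0 : ℝ))
      (fun p : ℝ × ℝ => p.1 * Real.log (p.1 / p.2)) := by
  have hconv : Convex ℝ (Set.Ioi (0 : ℝ) ×ˢ Set.Ioi (0 : ℝ)) :=
    (convex_Ioi 0).prod (convex_Ioi 0)
  refine ⟨hconv, ?_⟩
  rintro ⟨x₁, m₁⟩ h₁ ⟨x₂, m₂⟩ h₂ α β hα hβ hαβ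
  have hmem := hconv h₁ h₂ hα hβ hαβ
  simp only [Set.mem_prod, Set.mem_Ioi, Prod.smul_mk, Prod.mk_add_mk, smul_eq_mul] at *
  obtain ⟨hx, hm⟩ := hmem
  set x := α * x₁ + β * x₂ with hxdef
  set m := α * m₁ + β * m₂ with hmdef
  have hs : 0 < x / m := div_pos hx hm
  have t₁ := mul_le_mul_of_nonneg_left (mul_log_div_tangent_le h₁.1 h₁.2 hs) hα
  have t₂ := mul_le_mul_of_nonneg_left (mul_log_div_tangent_le h₂.1 h₂.2 hs) hβ
  have e : m * (x / m) = x := by field_simp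
  calc x * Real.log (x / m)
      = x * Real.log (x / m) + x - m * (x / m) := by rw [e]; ring
    _ = α * (x₁ * Real.log (x / m) + x₁ - m₁ * (x / m)) +
          β * (x₂ * Real.log (x / m) + x₂ - m₂ * (x / m)) := by
        rw [hmdef, hxdef]; ring
    _ ≤ _ := add_le_add t₁ t₂

/-- The average of the entries of a vector, as a linear map. -/
noncomputable def meanMap (v : ℕ) : (Fin v → ℝ) →ₗ[ℝ] ℝ :=
  (1 / (v : ℝ)) • ∑ x, LinearMap.proj x

theorem meanMap_apply (v : ℕ) (c : Fin v → ℝ) : meanMap v c = (1 / (v : ℝ)) * ∑ x, c x := by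
  simp [meanMap]

theorem meanMap_pos {v : ℕ} (hv : 0 < v) {c : Fin v → ℝ} (hc : ∀ x, 0 < c x) :
    0 < meanMap v c := by
  have : Nonempty (Fin v) := ⟨⟨0, hv⟩⟩
  rw [meanMap_apply]
  have : 0 < ∑ x, c x := Finset.sum_pos (fun x _ => hc x) Finset.univ_nonempty
  positivity

/-- Mixing one entry of a vector with the average of the entries, as a linear map. -/
noncomputable def mixMap (v : ℕ) (η : ℝ) (h : Fin v) : (Fin v → ℝ) →ₗ[ℝ] ℝ :=
  η • LinearMap.proj h + (1 - η) • meanMap v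

theorem mixMap_apply (v : ℕ) (η : ℝ) (h : Fin v) (c : Fin v → ℝ) :
    mixMap v η h c = η * c h + (1 - η) * meanMap v c := by
  simp [mixMap]

theorem mixMap_pos {v : ℕ} (hv : 0 < v) {η : ℝ} (hη : η ∈ Set.Ioc (0 : ℝ) 1) (h : Fin v)
    {c : Fin v → ℝ} (hc : ∀ x, 0 < c x) : 0 < mixMap v η h c := by
  rw [mixMap_apply]
  exact add_pos_of_pos_of_nonneg (mul_pos hη.1 (hc h))
    (mul_nonneg (sub_nonneg.2 hη.2) (meanMap_pos hv hc).le)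

/-- The contribution of one output symbol, with column `c`, to the sum of relative entropies. -/
noncomputable def columnDiv (v : ℕ) (η : ℝ) (c : Fin v → ℝ) : ℝ :=
  ∑ h, mixMap v η h c * Real.log (mixMap v η h c / meanMap v c)

theorem convexOn_columnDiv {v : ℕ} (hv : 0 < v) {η : ℝ} (hη : η ∈ Set.Ioc (0 : ℝ) 1) :
    ConvexOn ℝ {c : Fin v → ℝ | ∀ x, 0 < c x} (columnDiv v η) := by
  have hconv : Convex ℝ {c : Fin v → ℝ | ∀ x, 0 < c x} := by
    have : {c : Fin v → ℝ | ∀ x, 0 < c x} = Set.univ.pi fun _ => Set.Ioi (0 : ℝ) := by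
      ext c; simp
    rw [this]
    exact convex_pi fun _ _ => convex_Ioi 0
  refine ⟨hconv, fun c hc d hd α β hα hβ hαβ => ?_⟩
  simp only [columnDiv, smul_eq_mul, Finset.mul_sum, ← Finset.sum_add_distrib]
  refine Finset.sum_le_sum fun h _ => ?_
  have key := convexOn_mul_log_div.2
    (x := (mixMap v η h c, meanMap v c)) ⟨mixMap_pos hv hη h hc, meanMap_pos hv hc⟩
    (y := (mixMap v η h d, meanMap v d)) ⟨mixMap_pos hv hη h hd, meanMap_pos hv hd⟩ hα hβ hαβ
  simpa only [Prod.smul_mk, Prod.mk_add_mk, smul_eq_mul, map_add, map_smul] using key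

theorem fPUT_pos {v k ε : ℝ} (hv : 0 < v) (hk : 0 ≤ k) (hε : 0 < ε) : 0 < fPUT v k ε := by
  have h : 1 < Real.exp ε := Real.one_lt_exp_iff.2 hε
  refine div_pos ?_ hv
  nlinarith

open Classical in
/-- At a vertex of the cube `[a, e^ε a]^v` the column divergence is a multiple of `FPUT`. -/
theorem exists_vertex_values {v : ℕ} (hv : 0 < v) {ε η a : ℝ} (hε : 0 < ε)
    (hη : η ∈ Set.Ioc (0 : ℝ) 1) (ha : 0 < a) {c : Fin v → ℝ}
    (hc : ∀ x, c x = a ∨ c x = Real.exp ε * a) :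
    ∃ k : Fin (v + 1), meanMap v c = a * fPUT v k.1 ε ∧
      columnDiv v η c = a * FPUT v k.1 ε η := by
  have hv' : (0 : ℝ) < v := by exact_mod_cast hv
  set S : Finset (Fin v) := Finset.univ.filter fun x => c x = Real.exp ε * a with hS
  have hcard : S.card ≤ v := by simpa using S.card_le_univ
  have sum_two : ∀ g : ℝ → ℝ, ∑ x, g (c x) =
      S.card * g (Real.exp ε * a) + (v - S.card) * g a := by
    intro g
    have hx : ∀ x, g (c x) =
        (if c x = Real.exp ε * a then g (Real.exp ε * a) - g a else 0) + g a := by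
      intro x
      split_ifs with h
      · rw [h]; ring
      · rw [(hc x).resolve_right h]; ring
    rw [Finset.sum_congr rfl fun x _ => hx x, Finset.sum_add_distrib, ← Finset.sum_filter]
    simp only [Finset.sum_const, nsmul_eq_mul, Finset.card_univ, Fintype.card_fin, ← hS]
    ring
  have hmean : meanMap v c = a * fPUT v S.card ε := by
    rw [meanMap_apply, sum_two fun t => t, fPUT]
    field_simp
    ring
  refine ⟨⟨S.card, Nat.lt_succ_of_le hcard⟩, hmean, ?_⟩
  have hf := fPUT_pos hv' (Nat.cast_nonneg S.card) hε
  have hfv : v * fPUT v S.card ε = S.card * Real.exp ε + v - S.card := by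
    rw [fPUT]; field_simp
  simp only [columnDiv, mixMap_apply, hmean, FPUT, LPUT]
  rw [sum_two fun t => (η * t + (1 - η) * (a * fPUT v S.card ε)) *
    Real.log ((η * t + (1 - η) * (a * fPUT v S.card ε)) / (a * fPUT v S.card ε))]
  set f := fPUT v S.card ε
  set E := Real.exp ε with hE
  have hEpos : 0 < E := Real.exp_pos ε
  have hη' : 0 ≤ (1 - η) * f := mul_nonneg (sub_nonneg.2 hη.2) hf.le
  have hd₁ : 0 < η * E + (1 - η) * f := add_pos_of_pos_of_nonneg (mul_pos hη.1 hEpos) hη'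
  have hd₂ : 0 < η + (1 - η) * f := add_pos_of_pos_of_nonneg hη.1 hη'
  have e₁ : η * (E * a) + (1 - η) * (a * f) = a * (η * E + (1 - η) * f) := by ring
  have e₂ : η * a + (1 - η) * (a * f) = a * (η + (1 - η) * f) := by ring
  rw [e₁, e₂, mul_div_mul_left _ _ ha.ne', mul_div_mul_left _ _ ha.ne',
    Real.log_div hd₁.ne' hf.ne', Real.log_div hd₂.ne' hf.ne']
  linear_combination (a * η * Real.log f) * hfv

/-- A positive column satisfying the privacy constraint has divergence at most
`max_k F / f` times its average. -/
theorem columnDiv_le {v : ℕ} (hv : 0 < v) {ε η : ℝ} (hε : 0 < ε)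
    (hη : η ∈ Set.Ioc (0 : ℝ) 1) {c : Fin v → ℝ} (hpos : ∀ x, 0 < c x)
    (hldp : ∀ x x', c x ≤ Real.exp ε * c x') :
    columnDiv v η c ≤ (⨆ k : Fin (v + 1), FPUT v k.1 ε η / fPUT v k.1 ε) * meanMap v c := by
  have : Nonempty (Fin v) := ⟨⟨0, hv⟩⟩
  have hv' : (0 : ℝ) < v := by exact_mod_cast hv
  set C := ⨆ k : Fin (v + 1), FPUT v k.1 ε η / fPUT v k.1 ε with hC
  obtain ⟨x₀, hx₀⟩ := Finite.exists_min c
  set a := c x₀ with ha_def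
  have ha : 0 < a := hpos x₀
  have hE : 1 ≤ Real.exp ε := (Real.one_lt_exp_iff.2 hε).le
  have haE : a ≤ Real.exp ε * a := le_mul_of_one_le_left ha.le hE
  have hmem : c ∈ convexHull ℝ (Set.univ.pi fun _ : Fin v => {a, Real.exp ε * a}) := by
    rw [convexHull_pi]
    intro x _
    rw [convexHull_pair, segment_eq_Icc haE]
    exact ⟨hx₀ x, hldp x x₀⟩
  have hconv : ConvexOn ℝ {c : Fin v → ℝ | ∀ x, 0 < c x}
      (columnDiv v η - fun c => (C • meanMap v) c) :=
    (convexOn_columnDiv hv hη).sub ((C • meanMap v).concaveOn (convexOn_columnDiv hv hη).1)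
  have hsub : (Set.univ.pi fun _ : Fin v => ({a, Real.exp ε * a} : Set ℝ)) ⊆
      {c : Fin v → ℝ | ∀ x, 0 < c x} := by
    intro d hd x
    rcases hd x (Set.mem_univ x) with h | h
    · rw [h]; exact ha
    · rw [Set.mem_singleton_iff.1 h]; exact ha.trans_le haE
  obtain ⟨d, hd, hle⟩ := hconv.exists_ge_of_mem_convexHull hsub hmem
  obtain ⟨k, hk₁, hk₂⟩ := exists_vertex_values hv hε hη ha (c := d) fun x => hd x (Set.mem_univ x)
  have hf := fPUT_pos hv' (Nat.cast_nonneg k.1) hε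
  have hkC : FPUT v k.1 ε η / fPUT v k.1 ε ≤ C :=
    le_ciSup (f := fun k : Fin (v + 1) => FPUT v k.1 ε η / fPUT v k.1 ε)
      (Set.finite_range _).bddAbove k
  rw [div_le_iff₀ hf] at hkC
  simp only [Pi.sub_apply, LinearMap.smul_apply, smul_eq_mul, hk₁, hk₂] at hle
  have := mul_le_mul_of_nonneg_left hkC ha.le
  linarith

/-- converse, asymmetric testing: For every ε-LDP mechanism `q`,
`min_h D(q̃_{h,η} ‖ q̃_0) ≤ (1/v) max_k F(v,k,ε,η)/f(v,k,ε)`. -/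
theorem stmt_10 (v b : ℕ) (hv : 2 ≤ v) (hb : 1 ≤ b) (ε η : ℝ) (hε : 0 < ε)
    (hη : η ∈ Set.Ioc (0 : ℝ) 1)
    (q : Fin v → Fin b → ℝ)
    (hq_nonneg : ∀ x y, 0 ≤ q x y)
    (hq_row : ∀ x, ∑ y, q x y = 1)
    (hq_ldp : ∀ x x' y, q x y ≤ Real.exp ε * q x' y)
    (qt : Fin v → Fin b → ℝ)
    (hqt : ∀ h y, qt h y =
      ∑ x, (η * (if h = x then 1 else 0) + (1 - η) / v) * q x y)
    (qt0 : Fin b → ℝ)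
    (hqt0 : ∀ y, qt0 y = ∑ x, (1 / (v : ℝ)) * q x y) :
    (⨅ h : Fin v, ∑ y, qt h y * Real.log (qt h y / qt0 y)) ≤
      (1 / (v : ℝ)) *
        ⨆ k : Fin (v + 1), FPUT v k.1 ε η / fPUT v k.1 ε := by
  have hv0 : 0 < v := by omega
  have hv' : (0 : ℝ) < v := by exact_mod_cast hv0
  have : Nonempty (Fin v) := ⟨⟨0, hv0⟩⟩
  set C := ⨆ k : Fin (v + 1), FPUT v k.1 ε η / fPUT v k.1 ε
  have h0 : ∀ y, qt0 y = meanMap v fun x => q x y := fun y => by rw [hqt0, meanMap_apply,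
    Finset.mul_sum]
  have h1 : ∀ h y, qt h y = mixMap v η h fun x => q x y := by
    intro h y
    rw [hqt, mixMap_apply, meanMap_apply]
    simp only [add_mul, Finset.sum_add_distrib, mul_ite, mul_one, mul_zero, ite_mul, zero_mul,
      Finset.sum_ite_eq, Finset.mem_univ, if_true, Finset.mul_sum]
    congr 1
    exact Finset.sum_congr rfl fun x _ => by ring
  have hcol : ∀ y, ∑ h, qt h y * Real.log (qt h y / qt0 y) ≤ C * qt0 y := by
    intro y
    by_cases hz : ∃ x, q x y = 0
    · obtain ⟨x₀, hx₀⟩ := hz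
      have hall : (fun x => q x y) = 0 := by
        funext x
        have := hq_ldp x x₀ y
        rw [hx₀, mul_zero] at this
        exact le_antisymm this (hq_nonneg x y)
      simp [h0, h1, hall]
    · push Not at hz
      have := columnDiv_le hv0 hε hη (c := fun x => q x y)
        (fun x => (hq_nonneg x y).lt_of_ne' (hz x)) fun x x' => hq_ldp x x' y
      simpa only [columnDiv, ← h0, ← h1] using this
  have hsum0 : ∑ y, qt0 y = 1 := by
    simp only [hqt0]
    rw [Finset.sum_comm]
    simp only [← Finset.mul_sum, hq_row]
    simp [hv'.ne']
  have htotal : ∑ h, ∑ y, qt h y * Real.log (qt h y / qt0 y) ≤ C := by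
    rw [Finset.sum_comm]
    calc _ ≤ ∑ y, C * qt0 y := Finset.sum_le_sum fun y _ => hcol y
      _ = C := by rw [← Finset.mul_sum, hsum0, mul_one]
  have hmin : (v : ℝ) * (⨅ h : Fin v, ∑ y, qt h y * Real.log (qt h y / qt0 y)) ≤
      ∑ h, ∑ y, qt h y * Real.log (qt h y / qt0 y) := by
    have := Finset.card_nsmul_le_sum Finset.univ
      (fun h : Fin v => ∑ y, qt h y * Real.log (qt h y / qt0 y)) _
      fun h _ => ciInf_le (Set.finite_range _).bddBelow h
    simpa using this
  rw [one_div, ← div_eq_inv_mul, le_div_iff₀ hv', mul_comm]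
  exact hmin.trans htotal
end

section
/- Let v ≥ 2, b ≥ 1, and r, k, λ ≥ 0 be integers, ε > 0, and let e_1, …, e_b be subsets of [v] forming a (v,k,λ)-design: every x ∈ [v] lies in exactly r of the sets e_y, every e_y has exactly k elements, and every pair of distinct x, x' ∈ [v] lies together in exactly λ of the sets e_y. Let q ∈ ℝ^{v×b} be the associated block design mechanism: q_{xy} = e^ε/(r·e^ε + b − r) if x ∈ e_y and q_{xy} = 1/(r·e^ε + b − r) otherwise. Then min over distinct pairs h ≠ h' in [v] of C(q_h, q_{h'}) = −log(1 − ((e^{ε/2} − 1)²/(v−1)) · k(v−k)/(k·e^ε + v − k)), where q_h denotes the h-th row of q. -/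
/-- The replication number and block size of a uniform regular set system satisfy `v r = b k`. -/
lemma card_mul_replication_eq {v b r k : ℕ} {e : Fin b → Finset (Fin v)}
    (hreg : ∀ x : Fin v, (Finset.univ.filter (fun y : Fin b => x ∈ e y)).card = r)
    (hunif : ∀ y : Fin b, (e y).card = k) : v * r = b * k := by
  have h := Finset.sum_card_bipartiteAbove_eq_sum_card_bipartiteBelow
    (s := (Finset.univ : Finset (Fin v))) (t := (Finset.univ : Finset (Fin b)))
    (fun x y => x ∈ e y)
  simpa [Finset.bipartiteAbove, Finset.bipartiteBelow, hreg, hunif] using h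

/-- In a `(v,k,λ)`-design with replication number `r`, one has `r + (v - 1) λ = r k`. -/
lemma replication_add_eq {v b r k lam : ℕ} {e : Fin b → Finset (Fin v)}
    (hreg : ∀ x : Fin v, (Finset.univ.filter (fun y : Fin b => x ∈ e y)).card = r)
    (hunif : ∀ y : Fin b, (e y).card = k)
    (hbal : ∀ x x' : Fin v, x ≠ x' →
      (Finset.univ.filter (fun y : Fin b => x ∈ e y ∧ x' ∈ e y)).card = lam) (x : Fin v) :
    r + (v - 1) * lam = r * k := by
  have h := Finset.sum_card_bipartiteAbove_eq_sum_card_bipartiteBelow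
    (s := (Finset.univ : Finset (Fin v))) (t := Finset.univ.filter (fun y : Fin b => x ∈ e y))
    (fun x' y => x' ∈ e y)
  simp only [Finset.bipartiteAbove, Finset.bipartiteBelow, Finset.filter_filter,
    Finset.filter_univ_mem, hunif, Finset.sum_const, hreg, smul_eq_mul] at h
  rw [← h, ← Finset.add_sum_erase _ _ (Finset.mem_univ x)]
  have h' : ∀ x' ∈ Finset.univ.erase x,
      (Finset.univ.filter (fun y : Fin b => x ∈ e y ∧ x' ∈ e y)).card = lam :=
    fun x' hx' => hbal x x' (Finset.ne_of_mem_erase hx').symm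
  rw [Finset.sum_congr rfl h']
  simp [hreg]

/-- The Chernoff sum of two rows with entries proportional to `E` on `A` resp. `B` and to `1`
elsewhere, in terms of the sizes of `A`, `B` and `A ∩ B`. -/
lemma sum_rpow_mul_rpow_eq {b : ℕ} (A B : Fin b → Prop) [DecidablePred A] [DecidablePred B]
    {E D : ℝ} (hE : 0 < E) (hD : 0 < D) (s : ℝ) :
    ∑ y, (if A y then E / D else 1 / D) ^ s * (if B y then E / D else 1 / D) ^ (1 - s) =
      ((b : ℝ) + (E ^ s - 1) * (Finset.univ.filter A).card
        + (E ^ (1 - s) - 1) * (Finset.univ.filter B).card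
        + (E - E ^ s - E ^ (1 - s) + 1) * (Finset.univ.filter fun y => A y ∧ B y).card) / D := by
  have hEE : E ^ s * E ^ (1 - s) = E := by
    rw [← Real.rpow_add hE]; simp
  have hDD : D ^ s * D ^ (1 - s) = D := by
    rw [← Real.rpow_add hD]; simp
  have hterm : ∀ y, (if A y then E / D else 1 / D) ^ s * (if B y then E / D else 1 / D) ^ (1 - s) =
      (1 + (E ^ s - 1) * (if A y then 1 else 0) + (E ^ (1 - s) - 1) * (if B y then 1 else 0)
        + (E - E ^ s - E ^ (1 - s) + 1) * (if A y ∧ B y then 1 else 0)) / D := by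
    intro y
    by_cases hA : A y <;> by_cases hB : B y <;>
      simp only [hA, hB, if_true, if_false, and_true, and_false, Real.div_rpow hE.le hD.le,
        Real.div_rpow zero_le_one hD.le, Real.one_rpow, div_mul_div_comm, hEE, hDD] <;> ring
  rw [Finset.sum_congr rfl fun y _ => hterm y, ← Finset.sum_div]
  simp only [Finset.sum_add_distrib, ← Finset.mul_sum, Finset.sum_boole, Finset.sum_const,
    Finset.card_univ, Fintype.card_fin, nsmul_eq_mul, mul_one]

/-- By the inequality of arithmetic and geometric means, `2 e^{ε/2} ≤ e^{εs} + e^{ε(1-s)}`. -/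
lemma two_mul_exp_half_le (ε s : ℝ) :
    2 * Real.exp (ε / 2) ≤ Real.exp ε ^ s + Real.exp ε ^ (1 - s) := by
  have h : ∀ t, Real.exp ε ^ t = Real.exp (ε * t / 2) ^ 2 := by
    intro t
    rw [← Real.exp_mul, ← Real.exp_nat_mul]; congr 1; push_cast; ring
  have h2 : Real.exp (ε / 2) = Real.exp (ε * s / 2) * Real.exp (ε * (1 - s) / 2) := by
    rw [← Real.exp_add]; congr 1; ring
  rw [h, h, h2]
  nlinarith [sq_nonneg (Real.exp (ε * s / 2) - Real.exp (ε * (1 - s) / 2))]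


/-- achievability, symmetric testing: For a block design mechanism
`q` built from a `(v,k,λ)`-design, the minimum pairwise Chernoff information of
its rows equals `-log(1 - ((e^{ε/2}-1)²/(v-1)) · k(v-k)/(k e^ε + v - k))`. -/
theorem stmt_11 (v b r k lam : ℕ) (hv : 2 ≤ v) (hb : 1 ≤ b) (ε : ℝ) (hε : 0 < ε)
    (e : Fin b → Finset (Fin v))
    (hreg : ∀ x : Fin v, (Finset.univ.filter (fun y : Fin b => x ∈ e y)).card = r)
    (hunif : ∀ y : Fin b, (e y).card = k)
    (hbal : ∀ x x' : Fin v, x ≠ x' →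
      (Finset.univ.filter (fun y : Fin b => x ∈ e y ∧ x' ∈ e y)).card = lam)
    (q : Fin v → Fin b → ℝ)
    (hq : ∀ x y, q x y = if x ∈ e y
      then Real.exp ε / ((r : ℝ) * Real.exp ε + (b : ℝ) - r)
      else 1 / ((r : ℝ) * Real.exp ε + (b : ℝ) - r)) :
    sInf {c : ℝ | ∃ h h' : Fin v, h ≠ h' ∧
        c = -Real.log (sInf ((fun s : ℝ =>
          ∑ y, (q h y) ^ s * (q h' y) ^ (1 - s)) '' Set.Icc (0 : ℝ) 1))} =
      -Real.log (1 - ((Real.exp (ε / 2) - 1) ^ 2 / ((v : ℝ) - 1)) *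
        ((k : ℝ) * ((v : ℝ) - k) / ((k : ℝ) * Real.exp ε + (v : ℝ) - k))) := by
  have hx0 : Fin v := ⟨0, by omega⟩
  have hrb : r ≤ b := by
    rw [← hreg hx0]; exact (Finset.card_le_univ _).trans (by simp)
  have hkv : k ≤ v := by
    rw [← hunif ⟨0, hb⟩]; exact (Finset.card_le_univ _).trans (by simp)
  have hlam : lam ≤ r := by
    have hne : (⟨0, by omega⟩ : Fin v) ≠ ⟨1, by omega⟩ := by simp
    rw [← hbal _ _ hne, ← hreg ⟨0, by omega⟩]
    exact Finset.card_le_card fun y hy => by simp_all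
  have hE : 1 < Real.exp ε := Real.one_lt_exp_iff.mpr hε
  have hE0 : 0 < Real.exp ε := Real.exp_pos ε
  have hEsq : Real.exp ε = Real.exp (ε / 2) ^ 2 := by
    rw [← Real.exp_nat_mul]; congr 1; push_cast; ring
  have hrb' : (r : ℝ) ≤ b := by exact_mod_cast hrb
  have hkv' : (k : ℝ) ≤ v := by exact_mod_cast hkv
  have hlam' : (lam : ℝ) ≤ r := by exact_mod_cast hlam
  have hb' : (1 : ℝ) ≤ b := by exact_mod_cast hb
  have hv' : (2 : ℝ) ≤ v := by exact_mod_cast hv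
  have hr0 : (0 : ℝ) ≤ r := Nat.cast_nonneg r
  have hk0 : (0 : ℝ) ≤ k := Nat.cast_nonneg k
  have hvr : (v : ℝ) * r = b * k := by exact_mod_cast card_mul_replication_eq hreg hunif
  have hrk : (r : ℝ) + (v - 1) * lam = r * k := by
    have h := replication_add_eq hreg hunif hbal hx0
    rw [← Nat.cast_pred (by omega : 0 < v)]
    exact_mod_cast h
  have hD : 0 < (r : ℝ) * Real.exp ε + b - r := by nlinarith
  have hK : 0 < (k : ℝ) * Real.exp ε + v - k := by nlinarith
  have hv1 : (0 : ℝ) < v - 1 := by linarith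
  have hratio : ((r : ℝ) - lam) / (r * Real.exp ε + b - r) =
      k * (v - k) / ((v - 1) * (k * Real.exp ε + v - k)) := by
    have hv0 : (v : ℝ) ≠ 0 := by positivity
    have h1 : (v - 1) * ((r : ℝ) - lam) = r * (v - k) := by linear_combination -hrk
    rw [div_eq_div_iff hD.ne' (mul_pos hv1 hK).ne']
    apply mul_left_cancel₀ hv0
    linear_combination v * (k * Real.exp ε + v - k) * h1 +
      ((v - k) * (k * Real.exp ε + v - k) - k * (v - k) * (Real.exp ε - 1)) * hvr
  have hinf : ∀ h h' : Fin v, h ≠ h' → sInf ((fun s : ℝ =>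
      ∑ y, (q h y) ^ s * (q h' y) ^ (1 - s)) '' Set.Icc (0 : ℝ) 1) =
      1 - ((Real.exp (ε / 2) - 1) ^ 2 / ((v : ℝ) - 1)) *
        ((k : ℝ) * ((v : ℝ) - k) / ((k : ℝ) * Real.exp ε + (v : ℝ) - k)) := by
    intro h h' hne
    have hsum : ∀ s : ℝ, ∑ y, (q h y) ^ s * (q h' y) ^ (1 - s) =
        1 - (Real.exp ε + 1 - (Real.exp ε ^ s + Real.exp ε ^ (1 - s))) *
          (((r : ℝ) - lam) / (r * Real.exp ε + b - r)) := by
      intro s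
      simp only [hq]
      rw [sum_rpow_mul_rpow_eq (fun y => h ∈ e y) (fun y => h' ∈ e y) hE0 hD s,
        hreg, hreg, hbal h h' hne]
      field_simp
      ring
    have hval : 1 - ((Real.exp (ε / 2) - 1) ^ 2 / ((v : ℝ) - 1)) *
        ((k : ℝ) * ((v : ℝ) - k) / ((k : ℝ) * Real.exp ε + (v : ℝ) - k)) =
        1 - (Real.exp ε + 1 - 2 * Real.exp (ε / 2)) *
          (((r : ℝ) - lam) / (r * Real.exp ε + b - r)) := by
      rw [hratio, div_mul_div_comm, ← mul_div_assoc, hEsq]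
      ring
    simp only [hsum]
    rw [hval]
    refine IsLeast.csInf_eq ⟨⟨1 / 2, by norm_num, ?_⟩, ?_⟩
    · have hhalf : Real.exp ε ^ (1 / 2 : ℝ) = Real.exp (ε / 2) := by
        rw [← Real.exp_mul]; congr 1; ring
      have hhalf' : (1 : ℝ) - 1 / 2 = 1 / 2 := by norm_num
      simp only [hhalf', hhalf]
      ring
    · rintro _ ⟨s, -, rfl⟩
      have hnn : 0 ≤ ((r : ℝ) - lam) / (r * Real.exp ε + b - r) :=
        div_nonneg (sub_nonneg.mpr hlam') hD.le
      have := two_mul_exp_half_le ε s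
      beta_reduce
      gcongr
  refine (congrArg sInf ?_).trans (csInf_singleton _)
  ext c
  simp only [Set.mem_ofPred_eq, Set.mem_singleton_iff]
  constructor
  · rintro ⟨h, h', hne, rfl⟩
    rw [hinf h h' hne]
  · rintro rfl
    have hne : (⟨0, by omega⟩ : Fin v) ≠ ⟨1, by omega⟩ := by simp
    exact ⟨_, _, hne, by rw [hinf _ _ hne]⟩
end

section
/- Let v ≥ 2, b ≥ 1, and r, k, λ ≥ 0 be integers, ε > 0, and η ∈ (0,1]. Let e_1, …, e_b be subsets of [v] forming a (v,k,λ)-design, and let q ∈ ℝ^{v×b} be the associated block design mechanism: q_{xy} = e^ε/(r·e^ε + b − r) if x ∈ e_y and q_{xy} = 1/(r·e^ε + b − r) otherwise. Then min over h ∈ [v] of D(q̃_{h,η} ‖ q̃_0) = F(v,k,ε,η)/(v·f(v,k,ε)), where f(v,k,ε) = (k·e^ε + v − k)/v, Δ₁ = η·e^ε + (1−η)·f(v,k,ε), Δ₂ = η + (1−η)·f(v,k,ε), L(x) = x·log x, and F(v,k,ε,η) = k·L(Δ₁) + (v−k)·L(Δ₂) − v·L(f(v,k,ε)). -/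
theorem sum_ite_mem_const {ι : Type*} [Fintype ι] [DecidableEq ι] (s : Finset ι) (a c : ℝ) :
    ∑ x, (if x ∈ s then a else c) = s.card * a + (Fintype.card ι - s.card) * c := by
  have h : ∀ x, (if x ∈ s then a else c) = (if x ∈ s then a - c else 0) + c := by
    intro x
    split_ifs <;> ring
  simp only [h, Finset.sum_add_distrib, Finset.sum_ite_mem, Finset.univ_inter, Finset.sum_const,
    Finset.card_univ, nsmul_eq_mul]
  ring

/-- Double counting of incidences in a regular uniform hypergraph. -/
theorem card_mul_eq_of_regular_uniform {V B : Type*} [Fintype V] [Fintype B] [DecidableEq V]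
    {r k : ℕ} (e : B → Finset V)
    (hreg : ∀ x, (Finset.univ.filter (fun y => x ∈ e y)).card = r)
    (hunif : ∀ y, (e y).card = k) :
    Fintype.card V * r = Fintype.card B * k := by
  have h := Finset.sum_card_bipartiteAbove_eq_sum_card_bipartiteBelow
    (s := (Finset.univ : Finset V)) (t := (Finset.univ : Finset B)) (fun x y => x ∈ e y)
  simpa [Finset.bipartiteAbove, Finset.bipartiteBelow, hreg, hunif] using h

theorem sum_smoothed_mul {v : ℕ} (η : ℝ) (h : Fin v) (p : Fin v → ℝ) :
    ∑ x, (η * (if h = x then 1 else 0) + (1 - η) / v) * p x =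
      η * p h + (1 - η) * ∑ x, (1 / (v : ℝ)) * p x := by
  simp only [add_mul, Finset.sum_add_distrib, Finset.mul_sum]
  congr 1
  · simp
  · exact Finset.sum_congr rfl fun x _ => by ring

/-- achievability, asymmetric testing: For a block design
mechanism `q` built from a `(v,k,λ)`-design,
`min_h D(q̃_{h,η} ‖ q̃_0) = F(v,k,ε,η)/(v f(v,k,ε))`. -/
theorem stmt_12 (v b r k lam : ℕ) (hv : 2 ≤ v) (hb : 1 ≤ b) (ε η : ℝ)
    (hε : 0 < ε) (hη : η ∈ Set.Ioc (0 : ℝ) 1)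
    (e : Fin b → Finset (Fin v))
    (hreg : ∀ x : Fin v, (Finset.univ.filter (fun y : Fin b => x ∈ e y)).card = r)
    (hunif : ∀ y : Fin b, (e y).card = k)
    (hbal : ∀ x x' : Fin v, x ≠ x' →
      (Finset.univ.filter (fun y : Fin b => x ∈ e y ∧ x' ∈ e y)).card = lam)
    (q : Fin v → Fin b → ℝ)
    (hq : ∀ x y, q x y = if x ∈ e y
      then Real.exp ε / ((r : ℝ) * Real.exp ε + (b : ℝ) - r)
      else 1 / ((r : ℝ) * Real.exp ε + (b : ℝ) - r))
    (qt : Fin v → Fin b → ℝ)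
    (hqt : ∀ h y, qt h y =
      ∑ x, (η * (if h = x then 1 else 0) + (1 - η) / v) * q x y)
    (qt0 : Fin b → ℝ)
    (hqt0 : ∀ y, qt0 y = ∑ x, (1 / (v : ℝ)) * q x y) :
    (⨅ h : Fin v, ∑ y, qt h y * Real.log (qt h y / qt0 y)) =
      FPUT v k ε η / ((v : ℝ) * fPUT v k ε) := by
  classical
  obtain ⟨hη0, hη1⟩ := hη
  have : Nonempty (Fin v) := ⟨⟨0, by omega⟩⟩
  have hv0 : (0 : ℝ) < v := by exact_mod_cast (by omega : 0 < v)
  have hb0 : (0 : ℝ) < b := by exact_mod_cast hb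
  have hvr : (v : ℝ) * r = b * k := by
    have := card_mul_eq_of_regular_uniform e hreg hunif
    simp only [Fintype.card_fin] at this
    exact_mod_cast this
  have hkv : (k : ℝ) ≤ v := by
    have := Finset.card_le_univ (e ⟨0, hb⟩)
    rw [hunif, Fintype.card_fin] at this
    exact_mod_cast this
  have hE : 1 < Real.exp ε := Real.one_lt_exp_iff.2 hε
  have hk0 : (0 : ℝ) ≤ k := k.cast_nonneg
  unfold FPUT LPUT
  have hvf : (v : ℝ) * fPUT v k ε = k * Real.exp ε + v - k := by
    unfold fPUT
    field_simp
  generalize Real.exp ε = E at *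
  generalize fPUT v k ε = f at *
  have hf : 0 < f := by
    refine pos_of_mul_pos_right (a := (v : ℝ)) ?_ hv0.le
    nlinarith
  have hD : (r : ℝ) * E + b - r = b * f := by
    apply mul_left_cancel₀ hv0.ne'
    linear_combination (E - 1) * hvr - b * hvf
  have hΔ₁ : 0 < η * E + (1 - η) * f :=
    add_pos_of_pos_of_nonneg (by positivity) (mul_nonneg (by linarith) hf.le)
  have hΔ₂ : 0 < η + (1 - η) * f :=
    add_pos_of_pos_of_nonneg hη0 (mul_nonneg (by linarith) hf.le)
  have hsum : (k : ℝ) * (η * E + (1 - η) * f) + (v - k) * (η + (1 - η) * f) = v * f := by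
    linear_combination -η * hvf
  have h0 : ∀ y, qt0 y = f / (b * f) := by
    intro y
    rw [hqt0, ← Finset.mul_sum]
    simp only [hq, hD]
    rw [sum_ite_mem_const, hunif, Fintype.card_fin]
    field_simp
    linear_combination -hvf
  have h1 : ∀ h y, qt h y = (if h ∈ e y then η * E + (1 - η) * f
      else η + (1 - η) * f) / (b * f) := by
    intro h y
    rw [hqt, sum_smoothed_mul, ← hqt0, h0, hq, hD]
    split_ifs <;> ring
  have hdiv : ∀ h, ∑ y, qt h y * Real.log (qt h y / qt0 y) =
      (k * ((η * E + (1 - η) * f) * Real.log (η * E + (1 - η) * f))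
        + (v - k) * ((η + (1 - η) * f) * Real.log (η + (1 - η) * f))
        - v * (f * Real.log f)) / (v * f) := by
    intro h
    have hterm : ∀ y, qt h y * Real.log (qt h y / qt0 y) =
        if y ∈ Finset.univ.filter (fun y => h ∈ e y) then
          (η * E + (1 - η) * f) / (b * f) * (Real.log (η * E + (1 - η) * f) - Real.log f)
        else (η + (1 - η) * f) / (b * f) * (Real.log (η + (1 - η) * f) - Real.log f) := by
      intro y
      rw [h1, h0, div_div_div_cancel_right₀ (by positivity)]
      simp only [Finset.mem_filter, Finset.mem_univ, true_and]
      split_ifs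
      · rw [Real.log_div hΔ₁.ne' hf.ne']
      · rw [Real.log_div hΔ₂.ne' hf.ne']
    rw [Finset.sum_congr rfl fun y _ => hterm y, sum_ite_mem_const, hreg, Fintype.card_fin]
    have hr : (r : ℝ) = b * k / v := by
      rw [eq_div_iff hv0.ne', ← hvr, mul_comm]
    rw [hr]
    generalize η * E + (1 - η) * f = Δ₁ at *
    generalize η + (1 - η) * f = Δ₂ at *
    field_simp
    linear_combination -Real.log f * hsum
  simp only [hdiv, ciInf_const]
end

section
/- Let v ≥ 2 be a real number and ε > 0. Define K_S(k) = k(v−k)/(k·e^ε + v − k) for real k ∈ [0, v]. Then K_S attains its maximum over [0, v] at the unique point k₀ = v/(e^{ε/2} + 1); that is, K_S(k) ≤ K_S(k₀) for all k ∈ [0, v], with equality only at k = k₀. -/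
/-- The gap between `v / (t + 1) ^ 2` and `k (v - k) / (k t² + v - k)` is a square over a
positive denominator. -/
lemma div_sub_mul_sub_div_eq_sq_div {v t k : ℝ} (ht : t + 1 ≠ 0) (hD : k * t ^ 2 + v - k ≠ 0) :
    v / (t + 1) ^ 2 - k * (v - k) / (k * t ^ 2 + v - k) =
      (v - k * (t + 1)) ^ 2 / ((t + 1) ^ 2 * (k * t ^ 2 + v - k)) := by
  rw [div_sub_div _ _ (pow_ne_zero 2 ht) hD]
  ring

/-- `K_S(k) = k(v-k)/(k e^ε + v - k)` attains its maximum over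
`[0,v]` uniquely at `k₀ = v/(e^{ε/2} + 1)`. -/
theorem stmt_13 (v ε : ℝ) (hv : 2 ≤ v) (hε : 0 < ε)
    (K : ℝ → ℝ) (hK : ∀ k : ℝ, K k = k * (v - k) / (k * Real.exp ε + v - k))
    (k₀ : ℝ) (hk₀ : k₀ = v / (Real.exp (ε / 2) + 1)) :
    (∀ k ∈ Set.Icc (0 : ℝ) v, K k ≤ K k₀) ∧
    (∀ k ∈ Set.Icc (0 : ℝ) v, K k = K k₀ → k = k₀) := by
  have hexp : Real.exp ε = Real.exp (ε / 2) ^ 2 := by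
    rw [← Real.exp_nat_mul]
    congr 1
    push_cast
    ring
  have ht : 1 < Real.exp (ε / 2) := Real.one_lt_exp_iff.mpr (by linarith)
  simp only [hexp] at hK
  generalize Real.exp (ε / 2) = t at hK hk₀ ht
  have ht1 : 0 < t + 1 := by linarith
  have hD : ∀ k, 0 ≤ k → 0 < k * t ^ 2 + v - k := fun k hk ↦ by
    nlinarith [mul_nonneg hk (by nlinarith : 0 ≤ t ^ 2 - 1)]
  have hgap : ∀ k, 0 ≤ k → v / (t + 1) ^ 2 - K k =
      (v - k * (t + 1)) ^ 2 / ((t + 1) ^ 2 * (k * t ^ 2 + v - k)) := fun k hk ↦ by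
    rw [hK, div_sub_mul_sub_div_eq_sq_div ht1.ne' (hD k hk).ne']
  have hk₀_nonneg : 0 ≤ k₀ := by
    rw [hk₀]
    positivity
  have hmax : K k₀ = v / (t + 1) ^ 2 := by
    have h := hgap k₀ hk₀_nonneg
    rw [show v - k₀ * (t + 1) = 0 by rw [hk₀, div_mul_cancel₀ _ ht1.ne', sub_self]] at h
    simp only [ne_eq, OfNat.ofNat_ne_zero, not_false_eq_true, zero_pow, zero_div] at h
    linarith
  rw [hmax]
  refine ⟨fun k hk ↦ ?_, fun k hk heq ↦ ?_⟩
  · have hDk := hD k hk.1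
    rw [← sub_nonneg, hgap k hk.1]
    positivity
  · have h := hgap k hk.1
    have hDk := hD k hk.1
    rw [heq, sub_self, eq_comm, div_eq_zero_iff, or_iff_left (by positivity),
      sq_eq_zero_iff] at h
    rw [hk₀, eq_div_iff ht1.ne']
    linarith
end

section
/- Let v ≥ 2 be a real number and ε > 0. Define K_A(k) = k·ε·e^ε/(k·e^ε + v − k) + log(v/(k·e^ε + v − k)) for real k ∈ [0, v]. Then K_A attains its maximum over [0, v] at the unique point k₀ = v·(ε·e^ε − e^ε + 1)/(e^ε − 1)²; that is, K_A(k) ≤ K_A(k₀) for all k ∈ [0, v], with equality only at k = k₀. -/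
/-- `K_A(k) = k ε e^ε/(k e^ε + v - k) + log(v/(k e^ε + v - k))`
attains its maximum over `[0,v]` uniquely at
`k₀ = v(ε e^ε - e^ε + 1)/(e^ε - 1)²`. -/
theorem stmt_14 (v ε : ℝ) (hv : 2 ≤ v) (hε : 0 < ε)
    (K : ℝ → ℝ)
    (hK : ∀ k : ℝ, K k = k * ε * Real.exp ε / (k * Real.exp ε + v - k)
      + Real.log (v / (k * Real.exp ε + v - k)))
    (k₀ : ℝ)
    (hk₀ : k₀ = v * (ε * Real.exp ε - Real.exp ε + 1) / (Real.exp ε - 1) ^ 2) :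
    (∀ k ∈ Set.Icc (0 : ℝ) v, K k ≤ K k₀) ∧
    (∀ k ∈ Set.Icc (0 : ℝ) v, K k = K k₀ → k = k₀) := by
  have hE : 0 < Real.exp ε - 1 := by linarith [Real.add_one_lt_exp hε.ne']
  have hEp := Real.exp_pos ε
  set E := Real.exp ε
  obtain ⟨c, hc⟩ : ∃ c, c = ε * E / (E - 1) := ⟨_, rfl⟩
  have hcpos : 0 < c := by rw [hc]; positivity
  have hvpos : 0 < v := by linarith
  have hcE : c * (E - 1) = ε * E := by rw [hc]; field_simp
  have hK' : ∀ k, 0 < k * E + v - k →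
      K k = c - 1 - Real.log c
        - (c * (v / (k * E + v - k)) - 1 - Real.log (c * (v / (k * E + v - k)))) := by
    intro k hk
    have hlin : k * ε * E / (k * E + v - k) = c - c * (v / (k * E + v - k)) := by
      field_simp
      linear_combination (-k) * hcE
    rw [hK, hlin, Real.log_mul hcpos.ne' (div_pos hvpos hk).ne']
    ring
  have hden₀ : k₀ * E + v - k₀ = c * v := by
    rw [hk₀, hc]
    field_simp
    ring
  have hratio₀ : c * (v / (c * v)) = 1 := by field_simp
  have hmax : K k₀ = c - 1 - Real.log c := by
    rw [hK' k₀ (by rw [hden₀]; positivity), hden₀, hratio₀]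
    simp
  have hden : ∀ k ∈ Set.Icc (0 : ℝ) v, 0 < k * E + v - k := fun k hk => by
    nlinarith [mul_nonneg hk.1 hE.le]
  refine ⟨fun k hk => ?_, fun k hk h => ?_⟩
  · rw [hmax, hK' k (hden k hk)]
    linarith [Real.log_le_sub_one_of_pos (mul_pos hcpos (div_pos hvpos (hden k hk)))]
  · have hd := hden k hk
    rw [hmax, hK' k hd] at h
    have hone : c * (v / (k * E + v - k)) = 1 := by
      by_contra hne
      linarith [Real.log_lt_sub_one_of_pos (mul_pos hcpos (div_pos hvpos hd)) hne]
    have hden_eq : c * v = k * E + v - k := by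
      rwa [← mul_div_assoc, div_eq_one_iff_eq hd.ne'] at hone
    exact mul_right_cancel₀ hE.ne' (by linear_combination -hden_eq - hden₀)
end

section
/- Let v ≥ 2 be an integer. Define, for ε > 0, Φ(ε) = −log(1 − ((e^{ε/2} − 1)²/(v−1)) · max_{k ∈ {0,1,…,v}} k(v−k)/(k·e^ε + v − k)). Then as ε → 0 from the right, Φ(ε)/ε² tends to v/(16(v−1)) if v is even, and to (v+1)/(16v) if v is odd. -/
open Filter Topology

lemma tendsto_neg_log_one_sub_div {α : Type*} {l : Filter α} {x g : α → ℝ} {c : ℝ}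
    (hx : Tendsto x l (𝓝 0)) (h : Tendsto (fun a => x a / g a) l (𝓝 c)) :
    Tendsto (fun a => -Real.log (1 - x a) / g a) l (𝓝 c) := by
  set f : ℝ → ℝ := fun y => -Real.log (1 - y) with hf
  have hd : HasDerivAt f 1 0 := by
    have h1 : HasDerivAt (fun y : ℝ => 1 - y) (-1) 0 := (hasDerivAt_id (0 : ℝ)).const_sub 1
    have h2 := (h1.log (by norm_num)).fun_neg
    norm_num at h2
    exact h2
  have hcont : Tendsto (dslope f 0) (𝓝 0) (𝓝 1) := by
    have := (continuousAt_dslope_same.2 hd.differentiableAt).tendsto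
    rwa [dslope_same, hd.deriv] at this
  have hmul := h.mul (hcont.comp hx)
  rw [mul_one] at hmul
  refine hmul.congr fun a => ?_
  have hs := sub_smul_dslope f 0 (x a)
  have h0 : f 0 = 0 := by simp [hf]
  rw [h0, sub_zero, sub_zero, smul_eq_mul] at hs
  rw [Function.comp_apply, div_mul_eq_mul_div, hs]

lemma tendsto_exp_half_sub_one_div :
    Tendsto (fun ε : ℝ => (Real.exp (ε / 2) - 1) / ε) (𝓝[>] 0) (𝓝 (1 / 2)) := by
  have hd : HasDerivAt (fun ε : ℝ => Real.exp (ε / 2)) (1 / 2) 0 := by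
    simpa using ((hasDerivAt_id (0 : ℝ)).div_const 2).exp
  have hsub : Set.Ioi (0 : ℝ) ⊆ {0}ᶜ := fun x hx => ne_of_gt hx
  have h := (hasDerivAt_iff_tendsto_slope.1 hd).mono_left (nhdsWithin_mono (0 : ℝ) hsub)
  simpa [slope_fun_def_field] using h

lemma tendsto_iSup_mul_sub_div (v m : ℕ) (hv : 0 < v) (hm : m ≤ v)
    (hmax : ∀ k : ℕ, k ≤ v → (k : ℝ) * ((v : ℝ) - k) ≤ m * ((v : ℝ) - m)) :
    Tendsto (fun ε : ℝ => ⨆ k : Fin (v + 1),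
        ((k.1 : ℝ) * ((v : ℝ) - k.1)) / ((k.1 : ℝ) * Real.exp ε + (v : ℝ) - k.1))
      (𝓝[>] 0) (𝓝 ((m : ℝ) * ((v : ℝ) - m) / v)) := by
  have hv' : (0 : ℝ) < v := by exact_mod_cast hv
  have hm' : (m : ℝ) ≤ v := by exact_mod_cast hm
  have hlow : Tendsto (fun ε : ℝ => (m : ℝ) * ((v : ℝ) - m) / (m * Real.exp ε + v - m))
      (𝓝[>] 0) (𝓝 ((m : ℝ) * ((v : ℝ) - m) / v)) := by
    have hc : ContinuousAt
        (fun ε : ℝ => (m : ℝ) * ((v : ℝ) - m) / (m * Real.exp ε + v - m)) 0 := by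
      refine ContinuousAt.div (by fun_prop) (by fun_prop) ?_
      simpa using hv'.ne'
    have h := hc.tendsto.mono_left (nhdsWithin_le_nhds (s := Set.Ioi 0))
    simpa using h
  refine tendsto_of_tendsto_of_tendsto_of_le_of_le' hlow tendsto_const_nhds ?_ ?_
  · exact Eventually.of_forall fun ε => le_ciSup
      (f := fun k : Fin (v + 1) =>
        ((k.1 : ℝ) * ((v : ℝ) - k.1)) / ((k.1 : ℝ) * Real.exp ε + (v : ℝ) - k.1))
      (Set.finite_range _).bddAbove ⟨m, Nat.lt_succ_of_le hm⟩
  · filter_upwards [self_mem_nhdsWithin] with ε hε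
    refine ciSup_le fun k => ?_
    have hexp : 1 ≤ Real.exp ε := Real.one_le_exp (le_of_lt hε)
    have hk : (0 : ℝ) ≤ k.1 := Nat.cast_nonneg _
    exact div_le_div₀ (mul_nonneg (Nat.cast_nonneg _) (sub_nonneg.2 hm'))
      (hmax k.1 (Nat.le_of_lt_succ k.2)) hv' (by nlinarith)

/-- As `ε → 0⁺`, the classical symmetric-testing PUT
`Φ(ε) = -log(1 - ((e^{ε/2}-1)²/(v-1)) max_{k∈{0,…,v}} k(v-k)/(k e^ε + v - k))`
satisfies `Φ(ε)/ε² → v/(16(v-1))` if `v` is even, and `→ (v+1)/(16v)` if `v` is odd. -/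
theorem stmt_15 (v : ℕ) (hv : 2 ≤ v) :
    Filter.Tendsto (fun ε : ℝ =>
        (-Real.log (1 - ((Real.exp (ε / 2) - 1) ^ 2 / ((v : ℝ) - 1)) *
          ⨆ k : Fin (v + 1),
            ((k.1 : ℝ) * ((v : ℝ) - k.1)) /
              ((k.1 : ℝ) * Real.exp ε + (v : ℝ) - k.1))) / ε ^ 2)
      (nhdsWithin 0 (Set.Ioi 0))
      (nhds (if Even v then (v : ℝ) / (16 * ((v : ℝ) - 1))
        else ((v : ℝ) + 1) / (16 * v))) := by
  have hv2 : (2 : ℝ) ≤ v := by exact_mod_cast hv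
  have hv1 : (v : ℝ) - 1 ≠ 0 := by linarith
  have hv0 : (v : ℝ) ≠ 0 := by linarith
  have hsup : Tendsto (fun ε : ℝ => ⨆ k : Fin (v + 1),
        ((k.1 : ℝ) * ((v : ℝ) - k.1)) / ((k.1 : ℝ) * Real.exp ε + (v : ℝ) - k.1))
      (𝓝[>] 0) (𝓝 (if Even v then (v : ℝ) / 4 else ((v : ℝ) ^ 2 - 1) / (4 * v))) := by
    split_ifs with he
    · obtain ⟨m, hm⟩ := he
      have hm' : (v : ℝ) = m + m := by exact_mod_cast hm
      convert tendsto_iSup_mul_sub_div v m (by omega) (by omega) ?_ using 2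
      · field_simp
        rw [hm']
        ring
      · intro k _
        rw [hm']
        nlinarith [sq_nonneg ((k : ℝ) - m)]
    · obtain ⟨m, hm⟩ := Nat.not_even_iff_odd.1 he
      have hm' : (v : ℝ) = 2 * m + 1 := by exact_mod_cast hm
      convert tendsto_iSup_mul_sub_div v m (by omega) (by omega) ?_ using 2
      · field_simp
        rw [hm']
        ring
      · intro k _
        rw [hm']
        rcases le_or_gt k m with h | h
        · have h' : (k : ℝ) ≤ m := by exact_mod_cast h
          nlinarith
        · have h' : (m : ℝ) + 1 ≤ k := by exact_mod_cast h
          nlinarith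
  refine tendsto_neg_log_one_sub_div ?_ ?_
  · have hc : ContinuousAt (fun ε : ℝ => (Real.exp (ε / 2) - 1) ^ 2 / ((v : ℝ) - 1)) 0 := by
      fun_prop
    have h := (hc.tendsto.mono_left (nhdsWithin_le_nhds (s := Set.Ioi 0))).mul hsup
    simpa using h
  · have h := ((tendsto_exp_half_sub_one_div.pow 2).div_const ((v : ℝ) - 1)).mul hsup
    convert h using 2 with ε
    · rw [div_pow]
      ring
    · split_ifs
      · field_simp
        norm_num
      · field_simp
        ring
end

section
/- Let v ≥ 2 be an integer. Define, for ε > 0, Ψ(ε) = max_{k ∈ {0,1,…,v}} ( k·ε·e^ε/(k·e^ε + v − k) + log(v/(k·e^ε + v − k)) ). Then as ε → 0 from the right, Ψ(ε)/ε² tends to 1/8 if v is even, and to (v² − 1)/(8v²) if v is odd. -/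
theorem testing_denom_pos {v k : ℕ} (hv : 2 ≤ v) (hk : k ≤ v) (x : ℝ) :
    0 < (k : ℝ) * Real.exp x + v - k := by
  have hv' : (2 : ℝ) ≤ v := by exact_mod_cast hv
  have hk' : (k : ℝ) ≤ v := by exact_mod_cast hk
  rcases Nat.eq_zero_or_pos k with rfl | h0
  · simp; linarith
  · have h0' : (0 : ℝ) < k := by exact_mod_cast h0
    have := mul_pos h0' (Real.exp_pos x)
    linarith

theorem hasDerivAt_testing_term {v k : ℕ} (hv : 2 ≤ v) (hk : k ≤ v) (x : ℝ) :
    HasDerivAt (fun ε : ℝ => (k : ℝ) * ε * Real.exp ε / ((k : ℝ) * Real.exp ε + (v : ℝ) - k)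
        + Real.log ((v : ℝ) / ((k : ℝ) * Real.exp ε + (v : ℝ) - k)))
      (x * ((k : ℝ) * (v - k) * Real.exp x / ((k : ℝ) * Real.exp x + v - k) ^ 2)) x := by
  have hD := (testing_denom_pos hv hk x).ne'
  have hv0 : (v : ℝ) ≠ 0 := by
    have : v ≠ 0 := by omega
    exact_mod_cast this
  have hE := Real.hasDerivAt_exp x
  have hd : HasDerivAt (fun ε : ℝ => (k : ℝ) * Real.exp ε + (v : ℝ) - k)
      ((k : ℝ) * Real.exp x) x := ((hE.const_mul (k : ℝ)).add_const (v : ℝ)).sub_const (k : ℝ)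
  have hn := ((hasDerivAt_id x).const_mul (k : ℝ)).mul hE
  have hq := (hasDerivAt_const x (v : ℝ)).div hd hD
  refine ((hn.div hd hD).add (hq.log (div_ne_zero hv0 hD))).congr_deriv ?_
  simp only [id, Pi.mul_apply, Pi.div_apply]
  field_simp
  ring

theorem tendsto_testing_term_div_sq {v k : ℕ} (hv : 2 ≤ v) (hk : k ≤ v) :
    Filter.Tendsto (fun ε : ℝ =>
        ((k : ℝ) * ε * Real.exp ε / ((k : ℝ) * Real.exp ε + (v : ℝ) - k)
          + Real.log ((v : ℝ) / ((k : ℝ) * Real.exp ε + (v : ℝ) - k))) / ε ^ 2)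
      (nhdsWithin 0 (Set.Ioi 0)) (nhds ((k : ℝ) * (v - k) / (2 * (v : ℝ) ^ 2))) := by
  have hv0 : (v : ℝ) ≠ 0 := by
    have : v ≠ 0 := by omega
    exact_mod_cast this
  have hpos : ∀ᶠ x : ℝ in nhdsWithin 0 (Set.Ioi 0), x ≠ 0 :=
    Filter.eventually_of_mem self_mem_nhdsWithin fun x hx => ne_of_gt hx
  refine HasDerivAt.lhopital_zero_nhdsGT
    (f' := fun x => x * ((k : ℝ) * (v - k) * Real.exp x / ((k : ℝ) * Real.exp x + v - k) ^ 2))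
    (g' := fun x => 2 * x)
    (Filter.Eventually.of_forall (hasDerivAt_testing_term hv hk))
    (Filter.Eventually.of_forall fun x => by simpa using hasDerivAt_pow 2 x)
    (hpos.mono fun x hx => mul_ne_zero two_ne_zero hx) ?_ ?_ ?_
  · have h := (hasDerivAt_testing_term hv hk 0).continuousAt.tendsto
    simp [hv0] at h
    exact h.mono_left nhdsWithin_le_nhds
  · have h : Filter.Tendsto (fun x : ℝ => x ^ 2) (nhds 0) (nhds (0 ^ 2)) :=
      (continuous_pow 2).tendsto 0
    rw [zero_pow two_ne_zero] at h
    exact h.mono_left nhdsWithin_le_nhds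
  · have hc : Continuous fun x : ℝ =>
        (k : ℝ) * (v - k) * Real.exp x / (2 * ((k : ℝ) * Real.exp x + v - k) ^ 2) := by
      refine Continuous.div (by fun_prop) (by fun_prop) fun x => ?_
      have := testing_denom_pos hv hk x
      positivity
    have h := (hc.tendsto 0).mono_left (nhdsWithin_le_nhds (s := Set.Ioi 0))
    simp only [Real.exp_zero, mul_one, add_sub_cancel_left] at h
    refine h.congr' (hpos.mono fun x hx => ?_)
    have := (testing_denom_pos hv hk x).ne'
    field_simp

theorem tendsto_ciSup_of_finite {α ι : Type*} [Fintype ι] [Nonempty ι] {l : Filter α}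
    {f : ι → α → ℝ} {a : ι → ℝ} (h : ∀ i, Filter.Tendsto (f i) l (nhds (a i))) :
    Filter.Tendsto (fun x => ⨆ i, f i x) l (nhds (⨆ i, a i)) := by
  simp_rw [← Finset.sup'_univ_eq_ciSup]
  exact Filter.Tendsto.finset_sup'_nhds_apply Finset.univ_nonempty fun i _ => h i

theorem iSup_mul_sub_div_sq {v : ℕ} (hv : 2 ≤ v) :
    ⨆ k : Fin (v + 1), ((k.1 : ℝ) * (v - k.1) / (2 * (v : ℝ) ^ 2)) =
      if Even v then (1 : ℝ) / 8 else ((v : ℝ) ^ 2 - 1) / (8 * (v : ℝ) ^ 2) := by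
  have hv0 : (0 : ℝ) < v := by
    have : 0 < v := by omega
    exact_mod_cast this
  refine le_antisymm (ciSup_le fun k => ?_) ?_
  · split_ifs with he
    · rw [div_le_div_iff₀ (by positivity) (by norm_num)]
      nlinarith [sq_nonneg ((v : ℝ) - 2 * k.1)]
    · have hz : (1 : ℤ) ≤ ((v : ℤ) - 2 * k.1) ^ 2 := by
        have h0 : (v : ℤ) - 2 * k.1 ≠ 0 := fun h => he ⟨k.1, by omega⟩
        have := sq_pos_of_ne_zero h0
        omega
      have hr : (1 : ℝ) ≤ ((v : ℝ) - 2 * k.1) ^ 2 := by exact_mod_cast hz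
      rw [div_le_div_iff₀ (by positivity) (by positivity)]
      have hv2 : (0 : ℝ) < (v : ℝ) ^ 2 := by positivity
      nlinarith [mul_le_mul_of_nonneg_left hr hv2.le]
  · refine le_ciSup_of_le (Set.finite_range _).bddAbove ⟨v / 2, by omega⟩ (le_of_eq ?_)
    split_ifs with he
    · obtain ⟨m, rfl⟩ := he
      have h2 : (m + m) / 2 = m := by omega
      simp only [h2]
      push_cast at hv0 ⊢
      have hm : (m : ℝ) ≠ 0 := by intro h; simp [h] at hv0
      field_simp
      ring
    · obtain ⟨m, rfl⟩ := Nat.not_even_iff_odd.mp he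
      have h2 : (2 * m + 1) / 2 = m := by omega
      simp only [h2]
      push_cast at hv0 ⊢
      field_simp
      ring


/-- As `ε → 0⁺`, the classical asymmetric-testing PUT
`Ψ(ε) = max_{k∈{0,…,v}} (k ε e^ε/(k e^ε + v - k) + log(v/(k e^ε + v - k)))`
satisfies `Ψ(ε)/ε² → 1/8` if `v` is even, and `→ (v²-1)/(8v²)` if `v` is odd. -/
theorem stmt_16 (v : ℕ) (hv : 2 ≤ v) :
    Filter.Tendsto (fun ε : ℝ =>
        (⨆ k : Fin (v + 1),
          ((k.1 : ℝ) * ε * Real.exp ε / ((k.1 : ℝ) * Real.exp ε + (v : ℝ) - k.1)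
            + Real.log ((v : ℝ) / ((k.1 : ℝ) * Real.exp ε + (v : ℝ) - k.1)))) / ε ^ 2)
      (nhdsWithin 0 (Set.Ioi 0))
      (nhds (if Even v then (1 : ℝ) / 8
        else ((v : ℝ) ^ 2 - 1) / (8 * (v : ℝ) ^ 2))) := by
  rw [← iSup_mul_sub_div_sq hv]
  have h := tendsto_ciSup_of_finite fun k : Fin (v + 1) =>
    tendsto_testing_term_div_sq hv (Nat.lt_succ_iff.mp k.2)
  refine h.congr fun ε => ?_
  simp_rw [div_eq_mul_inv _ (ε ^ 2)]
  exact (Real.iSup_mul_of_nonneg (inv_nonneg.mpr (sq_nonneg ε)) _).symm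
end

section
/- Let v be an integer with 3 ≤ v ≤ 9, let d = ⌈√v⌉ (the least integer whose square is at least v), and set c_* = 1/(d+1). For ε > 0 define g_*^−(ε) = (1 − √(1 + (1−c_*)/sinh²(ε/2)))/2, μ_*(ε) = d·g_*^−(ε)/(d·g_*^−(ε) − 1), and G(c,d,μ) = c + ((1−c)/d)·((d−2)μ + 2√(μ(d−(d−1)μ))). Then there exists ε₁ > 0 such that for all ε ∈ (0, ε₁], −log G(c_*, d, μ_*(ε)) > −log(1 − ((e^{ε/2} − 1)²/(v−1)) · max_{k ∈ {0,1,…,v}} k(v−k)/(k·e^ε + v − k)). -/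
/-- Closed form of the affinity `G` at the optimal depolarizing parameter, in terms of
`s = sinh (ε / 2)`, `r = √(s² + A)` and `a = √A` with `A = D / (D + 1)`. -/
lemma affinity_eq (D s r a c g m : ℝ) (hD : 2 ≤ D) (hs : 0 < s) (ha : 0 < a) (hr : s < r)
    (hc : c = 1 / (D + 1)) (ha2 : a ^ 2 = 1 - c) (hr2 : r ^ 2 = s ^ 2 + (1 - c))
    (hg : g = (1 - Real.sqrt (1 + (1 - c) / s ^ 2)) / 2)
    (hm : m = D * g / (D * g - 1)) :
    0 < c + ((1 - c) / D) * ((D - 2) * m + 2 * Real.sqrt (m * (D - (D - 1) * m))) ∧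
    c + ((1 - c) / D) * ((D - 2) * m + 2 * Real.sqrt (m * (D - (D - 1) * m))) =
      1 - 2 * (1 - c) / ((r + a) * (D * (r - s) + 2 * s)) * s ^ 2 := by
  have hr0 : 0 < r := hs.trans hr
  have hq : 0 < D * (r - s) + 2 * s := by nlinarith
  have hsqrt : Real.sqrt (1 + (1 - c) / s ^ 2) = r / s := by
    rw [show 1 + (1 - c) / s ^ 2 = (r / s) ^ 2 by
      rw [div_pow, hr2]; field_simp]
    exact Real.sqrt_sq (by positivity)
  have hmq : m = D * (r - s) / (D * (r - s) + 2 * s) := by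
    have hden : D * ((1 - r / s) / 2) - 1 = -(D * (r - s) + 2 * s) / (2 * s) := by
      field_simp; ring
    rw [hm, hg, hsqrt, hden]
    field_simp
    ring
  have hroot : Real.sqrt (m * (D - (D - 1) * m)) = D * a / (D * (r - s) + 2 * s) := by
    rw [show m * (D - (D - 1) * m) = (D * a / (D * (r - s) + 2 * s)) ^ 2 by
      rw [hmq, div_pow, mul_pow, ha2, show 1 - c = r ^ 2 - s ^ 2 by linarith]
      generalize hqd : D * (r - s) + 2 * s = q at hq
      have hq0 := hq.ne'
      field_simp
      rw [← hqd]
      ring]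
    exact Real.sqrt_sq (by positivity)
  have hc0 : 0 < c := by rw [hc]; positivity
  have hc1 : 0 < 1 - c := by rw [← ha2]; positivity
  have hm0 : 0 ≤ m := by
    rw [hmq]
    exact div_nonneg (mul_nonneg (by linarith) (by linarith)) hq.le
  constructor
  · have h1 : 0 ≤ (D - 2) * m := mul_nonneg (by linarith) hm0
    positivity
  · have hs2 : s ^ 2 = r ^ 2 - a ^ 2 := by linarith
    have hra : 0 < r + a := by positivity
    have e : 2 * (1 - c) / ((r + a) * (D * (r - s) + 2 * s)) * s ^ 2 =
        2 * (1 - c) * (r - a) / (D * (r - s) + 2 * s) := by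
      rw [hs2]; field_simp; ring
    rw [e, hroot, hmq]
    field_simp
    ring

/-- The optimal classical subset-selection term is at most `v / 4`. -/
lemma iSup_subset_selection_le (v : ℕ) (hv : 0 < v) (E : ℝ) (hE : 1 ≤ E) :
    (⨆ k : Fin (v + 1), ((k.1 : ℝ) * ((v : ℝ) - k.1)) / ((k.1 : ℝ) * E + (v : ℝ) - k.1))
      ≤ (v : ℝ) / 4 := by
  refine ciSup_le fun k => ?_
  have hv' : (0 : ℝ) < v := by exact_mod_cast hv
  have hk0 : (0 : ℝ) ≤ k.1 := by positivity
  have hden : (v : ℝ) ≤ (k.1 : ℝ) * E + (v : ℝ) - k.1 := by nlinarith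
  rw [div_le_iff₀ (by linarith)]
  nlinarith [sq_nonneg ((v : ℝ) - 2 * k.1)]

/-- For small `ε`, the quantum loss coefficient dominates the classical one. -/
lemma eventually_loss_lt (D A B : ℝ) (hD : 0 < D) (hA : 0 < A) (hB : 4 * B < 4 / D) :
    ∀ᶠ ε in nhds (0 : ℝ),
      (2 * Real.exp (ε / 2) / (Real.exp (ε / 2) + 1)) ^ 2 * B <
      2 * A / ((Real.sqrt (Real.sinh (ε / 2) ^ 2 + A) + Real.sqrt A) *
        (D * (Real.sqrt (Real.sinh (ε / 2) ^ 2 + A) - Real.sinh (ε / 2))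
          + 2 * Real.sinh (ε / 2))) := by
  have hsA : Real.sqrt A ≠ 0 := (Real.sqrt_pos.2 hA).ne'
  refine ContinuousAt.eventually_lt ?_ ?_ ?_
  · refine ContinuousAt.mul (ContinuousAt.pow (ContinuousAt.div (by fun_prop) (by fun_prop) ?_) 2)
      continuousAt_const
    positivity
  · refine ContinuousAt.div (by fun_prop) (by fun_prop) ?_
    simp [hsA, hD.ne', ← two_mul]
  · have e : (Real.sqrt A + Real.sqrt A) * (D * Real.sqrt A) = 2 * A * D := by
      linear_combination 2 * D * Real.mul_self_sqrt hA.le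
    have e2 : 2 * A / (2 * A * D) = 1 / D := by field_simp
    have e3 : (4 : ℝ) / D = 4 * (1 / D) := by ring
    norm_num [e, e2]
    rw [e3, one_div] at hB
    linarith

/-- quantum advantage, symmetric testing: For `3 ≤ v ≤ 9` and
`d = ⌈√v⌉` (the least integer whose square is at least `v`), with `c_* = 1/(d+1)`,
there exists `ε₁ > 0` such that for all `ε ∈ (0, ε₁]`, the quantum utility
`-log G(c_*, d, μ_*(ε))` strictly exceeds the optimal classical PUT
`-log(1 - ((e^{ε/2}-1)²/(v-1)) max_k k(v-k)/(k e^ε + v - k))`. -/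
theorem stmt_18 (v d : ℕ) (hv3 : 3 ≤ v) (hv9 : v ≤ 9)
    (hd1 : v ≤ d ^ 2) (hd2 : ∀ m : ℕ, m < d → m ^ 2 < v)
    (cs : ℝ) (hcs : cs = 1 / ((d : ℝ) + 1))
    (g μst : ℝ → ℝ)
    (hg : ∀ ε : ℝ, g ε = (1 - Real.sqrt (1 + (1 - cs) / Real.sinh (ε / 2) ^ 2)) / 2)
    (hμ : ∀ ε : ℝ, μst ε = (d : ℝ) * g ε / ((d : ℝ) * g ε - 1)) :
    ∃ ε₁ > (0 : ℝ), ∀ ε ∈ Set.Ioc (0 : ℝ) ε₁,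
      -Real.log (cs + ((1 - cs) / d) * (((d : ℝ) - 2) * μst ε
          + 2 * Real.sqrt (μst ε * ((d : ℝ) - ((d : ℝ) - 1) * μst ε)))) >
      -Real.log (1 - ((Real.exp (ε / 2) - 1) ^ 2 / ((v : ℝ) - 1)) *
        ⨆ k : Fin (v + 1),
          ((k.1 : ℝ) * ((v : ℝ) - k.1)) /
            ((k.1 : ℝ) * Real.exp ε + (v : ℝ) - k.1)) := by
  have hd : d = 2 ∨ d = 3 := by
    have h3 : d ≤ 3 := by
      by_contra! h
      have := hd2 3 h
      omega
    interval_cases d <;> omega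
  have hv1 : (0 : ℝ) < (v : ℝ) - 1 := by
    have : (3 : ℝ) ≤ v := by exact_mod_cast hv3
    linarith
  have hD : (2 : ℝ) ≤ d := by rcases hd with rfl | rfl <;> norm_num
  have hA : 0 < 1 - cs := by
    rw [hcs, sub_pos, div_lt_one (by linarith)]
    linarith
  have hB : 4 * ((v : ℝ) / 4 / ((v : ℝ) - 1)) < 4 / (d : ℝ) := by
    rw [← mul_div_assoc, mul_div_cancel₀ _ (by norm_num : (4 : ℝ) ≠ 0),
      div_lt_div_iff₀ hv1 (by linarith)]
    rcases hd with rfl | rfl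
    · have : (3 : ℝ) ≤ v := by exact_mod_cast hv3
      push_cast
      linarith
    · have : (5 : ℝ) ≤ v := by exact_mod_cast hd2 2 (by norm_num)
      push_cast
      linarith
  obtain ⟨δ, hδ, H⟩ := Metric.eventually_nhds_iff.1
    (eventually_loss_lt d (1 - cs) _ (by linarith) hA hB)
  refine ⟨δ / 2, by positivity, fun ε hε => ?_⟩
  have hε0 : 0 < ε := hε.1
  have hlt := H (y := ε) (by
    rw [Real.dist_eq, sub_zero, abs_of_pos hε0]
    linarith [hε.2])
  have hs : 0 < Real.sinh (ε / 2) := Real.sinh_pos_iff.2 (by positivity)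
  obtain ⟨hpos, heq⟩ := affinity_eq d (Real.sinh (ε / 2))
    (Real.sqrt (Real.sinh (ε / 2) ^ 2 + (1 - cs))) (Real.sqrt (1 - cs)) cs (g ε) (μst ε)
    hD hs (Real.sqrt_pos.2 hA) (Real.lt_sqrt_of_sq_lt (by linarith)) hcs
    (Real.sq_sqrt hA.le) (Real.sq_sqrt (by positivity)) (hg ε) (hμ ε)
  refine neg_lt_neg (Real.log_lt_log hpos ?_)
  rw [heq]
  have hsup := iSup_subset_selection_le v (by omega) (Real.exp ε) (Real.one_le_exp hε0.le)
  have hE : 0 < Real.exp (ε / 2) := Real.exp_pos _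
  have hsinh : (Real.exp (ε / 2) - 1) ^ 2 =
      (2 * Real.exp (ε / 2) / (Real.exp (ε / 2) + 1)) ^ 2 * Real.sinh (ε / 2) ^ 2 := by
    rw [Real.sinh_eq, Real.exp_neg]
    field_simp
    ring
  have h1 := mul_le_mul_of_nonneg_left hsup
    (show 0 ≤ (Real.exp (ε / 2) - 1) ^ 2 / ((v : ℝ) - 1) by positivity)
  have h2 := mul_lt_mul_of_pos_right hlt (show 0 < Real.sinh (ε / 2) ^ 2 by positivity)
  have h3 : (Real.exp (ε / 2) - 1) ^ 2 / ((v : ℝ) - 1) * ((v : ℝ) / 4) =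
      (2 * Real.exp (ε / 2) / (Real.exp (ε / 2) + 1)) ^ 2 * ((v : ℝ) / 4 / ((v : ℝ) - 1)) *
        Real.sinh (ε / 2) ^ 2 := by
    rw [hsinh]; ring
  linarith
end

section
/- Let d ∈ {2, 3} and v = d², and set c_* = 1/(d+1). For ε > 0 define g_*^−(ε) = (1 − √(1 + (1−c_*)/sinh²(ε/2)))/2 and μ_*(ε) = d·g_*^−(ε)/(d·g_*^−(ε) − 1), and let L(x) = x·log x. Then there exists ε₀ > 0 such that for all ε ∈ (0, ε₀], log d + L(1 − μ_*(ε) + μ_*(ε)/d) + (d−1)·L(μ_*(ε)/d) > max_{k ∈ {0,1,…,v}} ( k·ε·e^ε/(k·e^ε + v − k) + log(v/(k·e^ε + v − k)) ). -/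
/-- The relative entropy of a two-valued exponentially tilted distribution is at most `x ^ 2 / 8`. -/
lemma tilted_divergence_le {a b x : ℝ} (ha : 0 ≤ a) (hb : 0 ≤ b) (hab : 0 < a + b) (hx : 0 ≤ x) :
    a * x * Real.exp x / (a * Real.exp x + b)
      + Real.log ((a + b) / (a * Real.exp x + b)) ≤ x ^ 2 / 8 := by
  have hpos (y : ℝ) : 0 < a * Real.exp y + b := by
    rcases ha.eq_or_lt with h | h
    · subst h; simpa using hab
    · have := Real.exp_pos y
      positivity
  set f : ℝ → ℝ := fun y ↦ a * y * Real.exp y / (a * Real.exp y + b)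
    - Real.log (a * Real.exp y + b) - y ^ 2 / 8 with hf
  have hderiv (y : ℝ) : HasDerivAt f
      (y * (a * Real.exp y * b / (a * Real.exp y + b) ^ 2 - 1 / 4)) y := by
    have hS : HasDerivAt (fun y ↦ a * Real.exp y + b) (a * Real.exp y) y :=
      ((Real.hasDerivAt_exp y).const_mul a).add_const b
    have hN : HasDerivAt (fun y ↦ a * y * Real.exp y)
        (a * 1 * Real.exp y + a * y * Real.exp y) y :=
      ((hasDerivAt_id' y).const_mul a).mul (Real.hasDerivAt_exp y)
    have hne := (hpos y).ne'
    refine (((hN.div hS hne).sub (hS.log hne)).sub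
      ((hasDerivAt_pow 2 y).div_const 8)).congr_deriv ?_
    field_simp
    ring
  have hanti : AntitoneOn f (Set.Ici 0) := by
    refine antitoneOn_of_deriv_nonpos (convex_Ici 0)
      (fun y _ ↦ (hderiv y).continuousAt.continuousWithinAt)
      (fun y _ ↦ (hderiv y).differentiableAt.differentiableWithinAt) fun y hy ↦ ?_
    rw [interior_Ici] at hy
    rw [(hderiv y).deriv]
    refine mul_nonpos_of_nonneg_of_nonpos (le_of_lt hy) ?_
    rw [sub_nonpos, div_le_iff₀ (pow_pos (hpos y) 2)]
    nlinarith [sq_nonneg (a * Real.exp y - b)]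
  have h := hanti Set.self_mem_Ici hx hx
  simp only [hf, Real.exp_zero] at h
  rw [Real.log_div hab.ne' (hpos x).ne']
  norm_num at h
  linarith

lemma one_add_mul_log_one_add_ge {x : ℝ} (hx : 0 ≤ x) :
    x + x ^ 2 / 2 - x ^ 3 / 4 ≤ (1 + x) * Real.log (1 + x) := by
  have h : (1 + x) * (2 * x / (x + 2)) ≤ (1 + x) * Real.log (1 + x) :=
    mul_le_mul_of_nonneg_left (Real.le_log_one_add_of_nonneg hx) (by linarith)
  refine le_trans ?_ h
  rw [← mul_div_assoc, le_div_iff₀ (by linarith)]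
  nlinarith [pow_nonneg hx 4]

lemma one_sub_mul_log_one_sub_ge {x : ℝ} (hx : 0 ≤ x) (hx1 : x < 1) :
    -x + x ^ 2 / 2 - x ^ 3 / 2 ≤ (1 - x) * Real.log (1 - x) := by
  have h := (abs_le.mp (Real.abs_log_sub_add_sum_range_le (abs_lt.mpr ⟨by linarith, hx1⟩) 2)).1
  rw [abs_of_nonneg hx] at h
  norm_num [Finset.sum_range_succ] at h
  have h1 : 0 < 1 - x := by linarith
  have h2 := mul_le_mul_of_nonneg_left h h1.le
  have h3 : (1 - x) * (x ^ 3 / (1 - x)) = x ^ 3 := by field_simp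
  nlinarith

/-- Second-order lower bound, with cubic error, for `log d` minus the entropy of the spectrum of a
depolarized pure state with visibility `t`. -/
lemma log_add_LPUT_ge {d t : ℝ} (hd : 1 ≤ d) (ht : 0 ≤ t) (ht1 : t < 1) :
    (d - 1) * t ^ 2 / 2 - ((d - 1) ^ 3 / 4 + (d - 1) / 2) / d * t ^ 3 ≤
      Real.log d + LPUT (1 - (1 - t) + (1 - t) / d) + (d - 1) * LPUT ((1 - t) / d) := by
  have hd0 : 0 < d := by linarith
  have hy : 0 ≤ (d - 1) * t := mul_nonneg (by linarith) ht
  have e1 : 1 - (1 - t) + (1 - t) / d = (1 + (d - 1) * t) / d := by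
    field_simp
    ring
  have hsplit : Real.log d + LPUT (1 - (1 - t) + (1 - t) / d) + (d - 1) * LPUT ((1 - t) / d)
      = ((1 + (d - 1) * t) * Real.log (1 + (d - 1) * t)
        + (d - 1) * ((1 - t) * Real.log (1 - t))) / d := by
    rw [e1, LPUT, LPUT, Real.log_div (by linarith) hd0.ne', Real.log_div (by linarith) hd0.ne']
    field_simp
    ring
  rw [hsplit, le_div_iff₀ hd0]
  have h1 := one_add_mul_log_one_add_ge hy
  have h2 := mul_le_mul_of_nonneg_left (one_sub_mul_log_one_sub_ge ht ht1)
    (by linarith : 0 ≤ d - 1)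
  refine le_trans (le_of_eq ?_) (add_le_add h1 h2)
  field_simp
  ring

lemma sinh_le_two_mul {x : ℝ} (hx : 0 ≤ x) (hx1 : x ≤ 1) : Real.sinh x ≤ 2 * x := by
  have h1 := (abs_le.mp (Real.abs_exp_sub_one_sub_id_le (abs_le.mpr ⟨by linarith, hx1⟩))).2
  have h2 := Real.add_one_le_exp (-x)
  rw [Real.sinh_eq]
  nlinarith

/-- quantum advantage, asymmetric testing: For `d ∈ {2,3}` and
`v = d²`, with `c_* = 1/(d+1)`, there exists `ε₀ > 0` such that for all
`ε ∈ (0, ε₀]`, the quantum utility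
`log d + L(1 - μ_*(ε) + μ_*(ε)/d) + (d-1) L(μ_*(ε)/d)` strictly exceeds the
optimal classical PUT
`max_k (k ε e^ε/(k e^ε + v - k) + log(v/(k e^ε + v - k)))`. -/
theorem stmt_19 (d : ℕ) (hd : d = 2 ∨ d = 3) (v : ℕ) (hv : v = d ^ 2)
    (cs : ℝ) (hcs : cs = 1 / ((d : ℝ) + 1))
    (g μst : ℝ → ℝ)
    (hg : ∀ ε : ℝ, g ε = (1 - Real.sqrt (1 + (1 - cs) / Real.sinh (ε / 2) ^ 2)) / 2)
    (hμ : ∀ ε : ℝ, μst ε = (d : ℝ) * g ε / ((d : ℝ) * g ε - 1)) :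
    ∃ ε₀ > (0 : ℝ), ∀ ε ∈ Set.Ioc (0 : ℝ) ε₀,
      Real.log d + LPUT (1 - μst ε + μst ε / d)
          + ((d : ℝ) - 1) * LPUT (μst ε / d) >
      ⨆ k : Fin (v + 1),
        ((k.1 : ℝ) * ε * Real.exp ε / ((k.1 : ℝ) * Real.exp ε + (v : ℝ) - k.1)
          + Real.log ((v : ℝ) / ((k.1 : ℝ) * Real.exp ε + (v : ℝ) - k.1))) := by
  have hd2 : (2 : ℝ) ≤ d := by rcases hd with rfl | rfl <;> norm_num
  have hv0 : (0 : ℝ) < v := by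
    rw [hv]
    push_cast
    positivity
  refine ⟨1 / 100, by norm_num, fun ε hε ↦ ?_⟩
  obtain ⟨hε0, hε1⟩ := hε
  have hclass : (⨆ k : Fin (v + 1),
        ((k.1 : ℝ) * ε * Real.exp ε / ((k.1 : ℝ) * Real.exp ε + (v : ℝ) - k.1)
          + Real.log ((v : ℝ) / ((k.1 : ℝ) * Real.exp ε + (v : ℝ) - k.1)))) ≤ ε ^ 2 / 8 := by
    refine ciSup_le fun k ↦ ?_
    have hk : (k.1 : ℝ) ≤ v := by exact_mod_cast Nat.lt_succ_iff.mp k.2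
    have h := tilted_divergence_le (a := (k.1 : ℝ)) (b := (v : ℝ) - k.1) (x := ε)
      (Nat.cast_nonneg _) (by linarith) (by linarith) hε0.le
    rwa [add_sub_cancel, ← add_sub_assoc] at h
  refine lt_of_le_of_lt hclass ?_
  set A : ℝ := (1 - cs) / Real.sinh (ε / 2) ^ 2 with hA
  have hs1 : ε / 2 ≤ Real.sinh (ε / 2) := Real.self_le_sinh_iff.mpr (by linarith)
  have hs2 : Real.sinh (ε / 2) ≤ ε := by
    have := sinh_le_two_mul (x := ε / 2) (by linarith) (by linarith)
    linarith
  have hs0 : 0 < Real.sinh (ε / 2) := by linarith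
  have hcs1 : 1 / 2 ≤ 1 - cs := by
    have : 1 / ((d : ℝ) + 1) ≤ 1 / 2 := one_div_le_one_div_of_le (by norm_num) (by linarith)
    rw [hcs]
    linarith
  have hA0 : 4900 ≤ A := by
    rw [hA, le_div_iff₀ (by positivity)]
    nlinarith
  have hAle : A * ε ^ 2 ≤ 4 * (1 - cs) := by
    have hm : A * Real.sinh (ε / 2) ^ 2 = 1 - cs := by
      rw [hA]
      field_simp
    nlinarith [mul_le_mul_of_nonneg_left (pow_le_pow_left₀ (by linarith) hs1 2)
      (by linarith : 0 ≤ A)]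
  set s : ℝ := Real.sqrt (1 + A) with hs
  have hs70 : 70 ≤ s := Real.le_sqrt_of_sq_le (by linarith)
  have hsq : s ^ 2 = 1 + A := Real.sq_sqrt (by linarith)
  set t : ℝ := 1 / (1 + d * (s - 1) / 2) with ht
  have hDpos : 70 ≤ 1 + d * (s - 1) / 2 := by nlinarith
  have htm : t * (1 + d * (s - 1) / 2) = 1 := one_div_mul_cancel (by linarith)
  have hμt : μst ε = 1 - t := by
    have hne : (d : ℝ) * ((1 - s) / 2) - 1 ≠ 0 := by nlinarith
    rw [hμ, hg, ← hA, ← hs, div_eq_iff hne]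
    linear_combination -htm
  have ht0 : 0 < t := by
    rw [ht]
    exact one_div_pos.mpr (by linarith)
  have ht1 : t ≤ 1 / 70 := one_div_le_one_div_of_le (by norm_num) hDpos
  have hsε : (s - 1) ^ 2 * ε ^ 2 ≤ 4 * (1 - cs) := by nlinarith [sq_nonneg ε]
  rw [hμt]
  refine lt_of_lt_of_le ?_ (log_add_LPUT_ge (by linarith) ht0.le (by linarith))
  have hεeq : ε = t * (ε + d * ((s - 1) * ε) / 2) := by linear_combination -ε * htm
  have ht2 : 0 < t ^ 2 := pow_pos ht0 2
  have ht3 : t ^ 3 ≤ t ^ 2 / 70 := by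
    have := mul_le_mul_of_nonneg_left ht1 ht2.le
    linarith
  rcases hd with rfl | rfl
  · norm_num at hcs hεeq ⊢
    have hw : (s - 1) * ε ≤ 164 / 100 := by
      refine (abs_le_of_sq_le_sq' ?_ (by norm_num)).2
      rw [mul_pow]
      linarith
    have hεt : ε ≤ (165 / 100) * t := by
      rw [hεeq, mul_comm _ t]
      exact mul_le_mul_of_nonneg_left (by linarith) ht0.le
    have := pow_le_pow_left₀ hε0.le hεt 2
    linarith
  · norm_num at hcs hεeq ⊢
    have hw : (s - 1) * ε ≤ 1733 / 1000 := by
      refine (abs_le_of_sq_le_sq' ?_ (by norm_num)).2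
      rw [mul_pow]
      linarith
    have hεt : ε ≤ (265 / 100) * t := by
      rw [hεeq, mul_comm _ t]
      exact mul_le_mul_of_nonneg_left (by linarith) ht0.le
    have := pow_le_pow_left₀ hε0.le hεt 2
    linarith
end
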